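/- arXiv:2504.08938 — 2 statements merged into one kernel-verified Lean document; each statement's English description precedes it below -/
import Mathlib

section
/- In dimensions d ≥ 3, the second-order extremal values satisfy U_2 = 1 and L_2 = −1. That is: for every n, every S ⊆ W_n with |S| = 2, and every ω ∈ Ω_n one has −(b−a) ≤ ∂_S f_n(ω) ≤ b−a; moreover there exist n, S with |S| = 2, and ω with ∂_S f_n(ω) = b−a, and there exist n, S with |S| = 2, and ω with ∂_S f_n(ω) = −(b−a). -/
noncomputable section

/-! ### First-passage percolation model

Vertices are points of `ℤ^d`; two vertices are adjacent when their ℓ¹-distance is `1`.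
For `n : ℕ`, the graph is restricted to the box `[-2n, 2n]^d`; `EdgeSet d n` is its edge
set `W_n`, and an environment `ω ∈ Ω_n = {a,b}^{W_n}` is modelled as a function
`Sym2 (Vtx d) → ℝ` whose values on `W_n` lie in `{a, b}` (`ValidEnv`).  `fppT d v n ω`
is the minimal passage time from the source `0` to the sink `n • v`. -/

abbrev Vtx (d : ℕ) : Type := Fin d → ℤ

/-- Two lattice points are adjacent when their ℓ¹ distance equals 1. -/
def adjV {d : ℕ} (x y : Vtx d) : Prop := (∑ i, |x i - y i|) = 1

/-- A vertex lies in the box `[-2n, 2n]^d`. -/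
def inBox {d : ℕ} (n : ℕ) (x : Vtx d) : Prop := ∀ i, |x i| ≤ (2 * n : ℤ)

/-- The edge set `W_n`: nearest-neighbour pairs inside the box. -/
def EdgeSet (d n : ℕ) : Set (Sym2 (Vtx d)) :=
  {e | ∃ x y : Vtx d, e = s(x, y) ∧ adjV x y ∧ inBox n x ∧ inBox n y}

/-- `p` is a path from `u` to `w` inside the box `[-2n, 2n]^d`. -/
def IsPath {d : ℕ} (n : ℕ) (u w : Vtx d) (p : List (Vtx d)) : Prop :=
  p.Chain' adjV ∧ p.head? = some u ∧ p.getLast? = some w ∧ ∀ x ∈ p, inBox n x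

/-- The passage time `T(p, ω)`: the sum of `ω_e` over the edges of `p`. -/
def pathTime {d : ℕ} (ω : Sym2 (Vtx d) → ℝ) (p : List (Vtx d)) : ℝ :=
  ((p.zip p.tail).map fun q => ω s(q.1, q.2)).sum

/-- The first-passage time `f_n(ω)`: minimal passage time from `0` to `n • v`. -/
def fppT (d : ℕ) (v : Vtx d) (n : ℕ) (ω : Sym2 (Vtx d) → ℝ) : ℝ :=
  sInf {t : ℝ | ∃ p : List (Vtx d), IsPath n 0 (fun i => (n : ℤ) * v i) p ∧ t = pathTime ω p}

/-- A geodesic: a path from `0` to `n • v` attaining the minimal passage time. -/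
def IsGeodesic (d : ℕ) (v : Vtx d) (n : ℕ) (ω : Sym2 (Vtx d) → ℝ) (p : List (Vtx d)) : Prop :=
  IsPath n 0 (fun i => (n : ℤ) * v i) p ∧ pathTime ω p = fppT d v n ω

/-- The list of edges traversed by a path. -/
def edgesOf {d : ℕ} (p : List (Vtx d)) : List (Sym2 (Vtx d)) :=
  (p.zip p.tail).map fun q => s(q.1, q.2)

/-- First-order environment derivative `∂_j φ = φ∘σ_j^b − φ∘σ_j^a`, where `σ_j^δ` sets
coordinate `j` to `δ`. -/
def envDeriv {E : Type*} [DecidableEq E] (a b : ℝ) (j : E) (φ : (E → ℝ) → ℝ) : (E → ℝ) → ℝ :=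
  fun ω => φ (Function.update ω j b) - φ (Function.update ω j a)

/-- Higher-order environment derivative `∂_S φ`, obtained by iterating the first-order
derivative over the elements of `S` (the recursion `∂_S φ = ∂_{S∖{j}}(∂_j φ)`; the result
is independent of the order). -/
def envDerivOn {E : Type*} [DecidableEq E] (a b : ℝ) (S : Finset E) (φ : (E → ℝ) → ℝ) :
    (E → ℝ) → ℝ :=
  S.toList.foldr (fun j ψ => envDeriv a b j ψ) φ

/-- `ω ∈ Ω_n = {a,b}^{W_n}`: the environment takes only the values `a`, `b` on `W_n`. -/
def ValidEnv (d n : ℕ) (a b : ℝ) (ω : Sym2 (Vtx d) → ℝ) : Prop :=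
  ∀ e ∈ EdgeSet d n, ω e = a ∨ ω e = b

section helpers

variable {d : ℕ}

lemma adjV_symm {x y : Vtx d} (h : adjV x y) : adjV y x := by
  unfold adjV at *
  rw [← h]
  exact Finset.sum_congr rfl fun i _ => abs_sub_comm _ _

lemma pathTime_cons (ω : Sym2 (Vtx d) → ℝ) (x y : Vtx d) (p : List (Vtx d)) :
    pathTime ω (x :: y :: p) = ω s(x, y) + pathTime ω (y :: p) := by
  simp [pathTime]

lemma pathTime_single (ω : Sym2 (Vtx d) → ℝ) (x : Vtx d) : pathTime ω [x] = 0 := by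
  simp [pathTime]

lemma isPath_single {n : ℕ} {x : Vtx d} (h : inBox n x) : IsPath n x x [x] := by
  refine ⟨List.IsChain.singleton x, rfl, rfl, ?_⟩
  intro y hy
  simp at hy
  exact hy ▸ h

lemma isPath_cons {n : ℕ} {x y w : Vtx d} {p : List (Vtx d)} :
    IsPath n x w (x :: y :: p) ↔ adjV x y ∧ inBox n x ∧ IsPath n y w (y :: p) := by
  unfold IsPath
  have e1 : List.Chain' adjV (x :: y :: p) ↔ adjV x y ∧ List.Chain' adjV (y :: p) :=
    List.isChain_cons_cons
  rw [e1]
  simp only [List.head?_cons, List.getLast?_cons_cons, List.mem_cons, forall_eq_or_imp]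
  tauto

lemma isPath_ne_nil {n : ℕ} {u w : Vtx d} {p : List (Vtx d)} (h : IsPath n u w p) :
    ∃ q, p = u :: q := by
  obtain ⟨_, h, _⟩ := h
  cases p with
  | nil => simp at h
  | cons a q => simp at h; exact ⟨q, by rw [h]⟩

lemma isPath_singleton_iff {n : ℕ} {x w : Vtx d} (h : IsPath n x w [x]) : x = w ∧ inBox n x := by
  obtain ⟨_, _, h1, h2⟩ := h
  simp at h1 h2
  exact ⟨h1, h2⟩

/-- Induction principle for paths. -/
lemma path_ind {n : ℕ} {w : Vtx d} (P : Vtx d → List (Vtx d) → Prop)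
    (h0 : inBox n w → P w [w])
    (h1 : ∀ x y p, adjV x y → inBox n x → IsPath n y w (y :: p) → P y (y :: p) →
      P x (x :: y :: p)) :
    ∀ p u, IsPath n u w p → P u p := by
  intro p
  induction p with
  | nil => intro u h; obtain ⟨q, hq⟩ := isPath_ne_nil h; simp at hq
  | cons a p ih =>
    intro u h
    obtain ⟨q, hq⟩ := isPath_ne_nil h
    simp at hq
    obtain ⟨rfl, _⟩ := hq
    cases p with
    | nil =>
      obtain ⟨rfl, h2⟩ := isPath_singleton_iff h
      exact h0 h2
    | cons y p =>
      obtain ⟨h2, h3, h4⟩ := isPath_cons.1 h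
      exact h1 _ _ _ h2 h3 h4 (ih _ h4)

lemma isPath_head_inBox {n : ℕ} {u w : Vtx d} {p : List (Vtx d)} (h : IsPath n u w p) :
    inBox n u := by
  obtain ⟨q, rfl⟩ := isPath_ne_nil h
  exact h.2.2.2 u (by simp)

lemma mem_edgeSet {n : ℕ} {x y : Vtx d} (h : adjV x y) (hx : inBox n x) (hy : inBox n y) :
    s(x, y) ∈ EdgeSet d n := ⟨x, y, rfl, h, hx, hy⟩

lemma pathTime_mono {n : ℕ} {u w : Vtx d} {ω ω' : Sym2 (Vtx d) → ℝ}
    (hω : ∀ e ∈ EdgeSet d n, ω e ≤ ω' e) (p : List (Vtx d)) (hp : IsPath n u w p) :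
    pathTime ω p ≤ pathTime ω' p := by
  refine path_ind (n := n) (w := w) (fun _ p => pathTime ω p ≤ pathTime ω' p) ?_ ?_ p u hp
  · intro _; simp [pathTime_single]
  · intro x y p h1 h2 h3 h4
    rw [pathTime_cons, pathTime_cons]
    exact add_le_add (hω _ (mem_edgeSet h1 h2 (isPath_head_inBox h3))) h4

lemma pathTime_nonneg {n : ℕ} {u w : Vtx d} {ω : Sym2 (Vtx d) → ℝ}
    (hω : ∀ e ∈ EdgeSet d n, 0 ≤ ω e) (p : List (Vtx d)) (hp : IsPath n u w p) :
    0 ≤ pathTime ω p := by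
  have := pathTime_mono (ω := fun _ => 0) (ω' := ω) hω p hp
  simpa [pathTime] using this

lemma pathTime_pot {n : ℕ} {u w : Vtx d} {ω : Sym2 (Vtx d) → ℝ} (h : Vtx d → ℝ)
    (hh : ∀ x y, adjV x y → h x - h y ≤ ω s(x, y)) (p : List (Vtx d)) (hp : IsPath n u w p) :
    h u - h w ≤ pathTime ω p := by
  refine path_ind (n := n) (w := w) (fun u p => h u - h w ≤ pathTime ω p) ?_ ?_ p u hp
  · intro _; simp [pathTime_single]
  · intro x y p h1 h2 h3 h4
    rw [pathTime_cons]
    have := hh x y h1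
    linarith

lemma pathTime_congr {ω ω' : Sym2 (Vtx d) → ℝ} (p : List (Vtx d))
    (h : ∀ x ∈ p, ∀ y ∈ p, ω s(x, y) = ω' s(x, y)) : pathTime ω p = pathTime ω' p := by
  induction p with
  | nil => rfl
  | cons x p ih =>
    cases p with
    | nil => simp [pathTime_single]
    | cons y p =>
      rw [pathTime_cons, pathTime_cons, h x (by simp) y (by simp), ih]
      intro x' hx' y' hy'
      exact h x' (List.mem_cons_of_mem _ hx') y' (List.mem_cons_of_mem _ hy')

lemma pathTime_update_le {ω : Sym2 (Vtx d) → ℝ} {a b : ℝ} (hab : a ≤ b) (j : Sym2 (Vtx d))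
    (p : List (Vtx d)) (hp : p.Nodup) :
    pathTime (Function.update ω j b) p ≤ pathTime (Function.update ω j a) p + (b - a) := by
  induction p with
  | nil => simp [pathTime]; linarith
  | cons x p ih =>
    cases p with
    | nil => simp [pathTime_single]; linarith
    | cons y p =>
      rw [pathTime_cons, pathTime_cons]
      obtain ⟨hx, hp'⟩ := List.nodup_cons.1 hp
      by_cases hj : s(x, y) = j
      · have : pathTime (Function.update ω j b) (y :: p)
            = pathTime (Function.update ω j a) (y :: p) := by
          apply pathTime_congr
          intro x' hx' y' hy'
          have hne : s(x', y') ≠ j := by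
            intro h
            have : x ∈ s(x', y') := by rw [h, ← hj]; simp
            rcases Sym2.mem_iff.1 this with h | h
            · exact hx (h ▸ hx')
            · exact hx (h ▸ hy')
          simp [Function.update_of_ne hne]
        rw [this, hj]
        simp
        linarith
      · rw [Function.update_of_ne hj, Function.update_of_ne hj]
        linarith [ih hp']

lemma exists_suffix {n : ℕ} {w : Vtx d} {ω : Sym2 (Vtx d) → ℝ}
    (hω : ∀ e ∈ EdgeSet d n, 0 ≤ ω e) (x : Vtx d) (q : List (Vtx d)) (u : Vtx d)
    (hq : IsPath n u w q) :
    x ∈ q → q.Nodup →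
      ∃ q', IsPath n x w q' ∧ q'.Nodup ∧ pathTime ω q' ≤ pathTime ω q := by
  refine path_ind (n := n) (w := w) (fun u q => x ∈ q → q.Nodup →
      ∃ q', IsPath n x w q' ∧ q'.Nodup ∧ pathTime ω q' ≤ pathTime ω q) ?_ ?_ q u hq
  · intro hw hx _
    simp at hx
    subst hx
    exact ⟨[x], isPath_single hw, by simp, le_rfl⟩
  · intro z y p h1 h2 h3 h4 hx hnd
    by_cases hz : x = z
    · subst hz
      exact ⟨_, isPath_cons.2 ⟨h1, h2, h3⟩, hnd, le_rfl⟩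
    · have hx' : x ∈ y :: p := by
        rcases List.mem_cons.1 hx with h | h
        · exact absurd h hz
        · exact h
      obtain ⟨q', a1, a2, a3⟩ := h4 hx' (List.nodup_cons.1 hnd).2
      refine ⟨q', a1, a2, ?_⟩
      rw [pathTime_cons]
      linarith [hω _ (mem_edgeSet h1 h2 (isPath_head_inBox h3))]

lemma exists_nodup {n : ℕ} {w : Vtx d} {ω : Sym2 (Vtx d) → ℝ}
    (hω : ∀ e ∈ EdgeSet d n, 0 ≤ ω e) (p : List (Vtx d)) (u : Vtx d) (hp : IsPath n u w p) :
    ∃ q, IsPath n u w q ∧ q.Nodup ∧ pathTime ω q ≤ pathTime ω p := by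
  refine path_ind (n := n) (w := w) (fun u p =>
      ∃ q, IsPath n u w q ∧ q.Nodup ∧ pathTime ω q ≤ pathTime ω p) ?_ ?_ p u hp
  · intro hw
    exact ⟨[w], isPath_single hw, by simp, le_rfl⟩
  · rintro x y p h1 h2 h3 ⟨q, a1, a2, a3⟩
    have h0 := hω _ (mem_edgeSet h1 h2 (isPath_head_inBox h3))
    by_cases hx : x ∈ q
    · obtain ⟨q', b1, b2, b3⟩ := exists_suffix hω x q y a1 hx a2
      refine ⟨q', b1, b2, ?_⟩
      rw [pathTime_cons]
      linarith
    · obtain ⟨r, rfl⟩ := isPath_ne_nil a1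
      refine ⟨x :: y :: r, isPath_cons.2 ⟨h1, h2, a1⟩, List.nodup_cons.2 ⟨hx, a2⟩, ?_⟩
      rw [pathTime_cons, pathTime_cons]
      linarith

lemma fppT_le {v : Vtx d} {n : ℕ} {ω : Sym2 (Vtx d) → ℝ}
    (hω : ∀ e ∈ EdgeSet d n, 0 ≤ ω e) {p : List (Vtx d)}
    (hp : IsPath n 0 (fun i => (n : ℤ) * v i) p) : fppT d v n ω ≤ pathTime ω p := by
  apply csInf_le
  · refine ⟨0, ?_⟩
    rintro t ⟨p, hp, rfl⟩
    exact pathTime_nonneg hω p hp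
  · exact ⟨p, hp, rfl⟩

lemma le_fppT {v : Vtx d} {n : ℕ} {ω : Sym2 (Vtx d) → ℝ} {c : ℝ} {p0 : List (Vtx d)}
    (hp0 : IsPath n 0 (fun i => (n : ℤ) * v i) p0)
    (h : ∀ p, IsPath n 0 (fun i => (n : ℤ) * v i) p → c ≤ pathTime ω p) : c ≤ fppT d v n ω := by
  apply le_csInf
  · exact ⟨_, p0, hp0, rfl⟩
  · rintro t ⟨p, hp, rfl⟩
    exact h p hp

lemma first_deriv {v : Vtx d} {n : ℕ} {a b : ℝ} (ha : 0 < a) (hab : a < b)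
    {ω : Sym2 (Vtx d) → ℝ} (hω : ValidEnv d n a b ω) (j : Sym2 (Vtx d)) :
    0 ≤ envDeriv a b j (fppT d v n) ω ∧ envDeriv a b j (fppT d v n) ω ≤ b - a := by
  have hv : ∀ c, 0 < c → ∀ e ∈ EdgeSet d n, 0 ≤ Function.update ω j c e := by
    intro c hc e he
    by_cases h : e = j
    · subst h; simp [hc.le]
    · rw [Function.update_of_ne h]
      rcases hω e he with h | h <;> rw [h] <;> linarith
  have hva := hv a ha
  have hvb := hv b (ha.trans hab)
  unfold envDeriv
  by_cases hne : ∃ p, IsPath n 0 (fun i => (n : ℤ) * v i) p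
  · obtain ⟨p0, hp0⟩ := hne
    constructor
    · rw [sub_nonneg]
      apply le_fppT hp0
      intro p hp
      refine (fppT_le hva hp).trans (pathTime_mono ?_ p hp)
      intro e _
      by_cases h : e = j
      · subst h; simp [hab.le]
      · simp [Function.update_of_ne h]
    · rw [sub_le_comm]
      apply le_fppT hp0
      intro p hp
      obtain ⟨q, h1, h2, h3⟩ := exists_nodup hva p _ hp
      have h4 := pathTime_update_le (ω := ω) hab.le j q h2
      have h5 := fppT_le hvb h1
      linarith
  · have : ∀ ω, fppT d v n ω = 0 := by
      intro ω
      have : {t : ℝ | ∃ p : List (Vtx d), IsPath n 0 (fun i => (n : ℤ) * v i) p ∧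
          t = pathTime ω p} = ∅ := by
        ext t
        simp only [Set.mem_ofPred_eq, Set.mem_empty_iff_false, iff_false]
        rintro ⟨p, hp, _⟩
        exact hne ⟨p, hp⟩
      unfold fppT
      rw [this, Real.sInf_empty]
    rw [this, this]
    constructor <;> linarith

lemma validEnv_update {n : ℕ} {a b : ℝ} {ω : Sym2 (Vtx d) → ℝ} (hω : ValidEnv d n a b ω)
    (j : Sym2 (Vtx d)) {c : ℝ} (hc : c = a ∨ c = b) :
    ValidEnv d n a b (Function.update ω j c) := by
  intro e he
  by_cases h : e = j
  · subst h; simpa using hc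
  · rw [Function.update_of_ne h]; exact hω e he

lemma toList_pair {E : Type*} {S : Finset E} (hS : S.card = 2) :
    ∃ x y, x ≠ y ∧ S.toList = [x, y] := by
  have h1 : S.toList.length = 2 := by rw [Finset.length_toList, hS]
  obtain ⟨x, y, h⟩ := List.length_eq_two.1 h1
  have h2 := S.nodup_toList
  rw [h] at h2
  simp at h2
  exact ⟨x, y, h2, h⟩

lemma envDerivOn_pair {E : Type*} [DecidableEq E] (a b : ℝ) (e1 e2 : E) (hne : e1 ≠ e2)
    (φ : (E → ℝ) → ℝ) (ω : E → ℝ) (F : ℝ → ℝ → ℝ)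
    (hF : ∀ x y, (x = a ∨ x = b) → (y = a ∨ y = b) →
      φ (Function.update (Function.update ω e1 x) e2 y) = F x y) :
    envDerivOn a b {e1, e2} φ ω = F b b - F a b - F b a + F a a := by
  obtain ⟨x, y, hxy, h⟩ := toList_pair (Finset.card_pair hne)
  have hm : ∀ z, z ∈ [x, y] ↔ z = e1 ∨ z = e2 := by
    intro z; rw [← h]; simp
  have hx := (hm x).1 (by simp)
  have hy := (hm y).1 (by simp)
  have hF' : ∀ x y, (x = a ∨ x = b) → (y = a ∨ y = b) →
      φ (Function.update (Function.update ω e2 y) e1 x) = F x y := by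
    intro x y h1 h2
    rw [Function.update_comm hne.symm, hF x y h1 h2]
  unfold envDerivOn
  rw [h]
  simp only [List.foldr, envDeriv]
  rcases hx with rfl | rfl <;> rcases hy with rfl | rfl
  · exact absurd rfl hxy
  · rw [hF, hF, hF, hF] <;> first | tauto | ring1
  · rw [hF', hF', hF', hF'] <;> first | tauto | ring1
  · exact absurd rfl hxy

lemma second_deriv_bound {v : Vtx d} {n : ℕ} {a b : ℝ} (ha : 0 < a) (hab : a < b)
    (S : Finset (Sym2 (Vtx d))) (hS : S.card = 2) {ω : Sym2 (Vtx d) → ℝ}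
    (hω : ValidEnv d n a b ω) :
    -(b - a) ≤ envDerivOn a b S (fppT d v n) ω ∧
      envDerivOn a b S (fppT d v n) ω ≤ b - a := by
  obtain ⟨x, y, hxy, h⟩ := toList_pair hS
  unfold envDerivOn
  rw [h]
  simp only [List.foldr]
  have h1 := first_deriv (v := v) ha hab (validEnv_update hω x (Or.inr rfl : b = a ∨ b = b)) y
  have h2 := first_deriv (v := v) ha hab (validEnv_update hω x (Or.inl rfl : a = a ∨ a = b)) y
  rw [envDeriv]
  constructor <;> linarith [h1.1, h1.2, h2.1, h2.2]

/-- There is a path from `x` to `T` of passage time at most `c`. -/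
def Reach (n : ℕ) (ω : Sym2 (Vtx d) → ℝ) (T x : Vtx d) (c : ℝ) : Prop :=
  ∃ p, IsPath n x T p ∧ pathTime ω p ≤ c

lemma reach_refl {n : ℕ} {ω : Sym2 (Vtx d) → ℝ} {T : Vtx d} (h : inBox n T) :
    Reach n ω T T 0 := ⟨[T], isPath_single h, by simp [pathTime_single]⟩

lemma reach_step {n : ℕ} {ω : Sym2 (Vtx d) → ℝ} {T x y : Vtx d} {c c' : ℝ} (hx : inBox n x)
    (h : adjV x y) (hy : Reach n ω T y c) (hc : ω s(x, y) + c ≤ c') : Reach n ω T x c' := by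
  obtain ⟨p, hp, hpc⟩ := hy
  obtain ⟨q, rfl⟩ := isPath_ne_nil hp
  refine ⟨x :: y :: q, isPath_cons.2 ⟨h, hx, hp⟩, ?_⟩
  rw [pathTime_cons]
  linarith

/-- `y` lies coordinatewise between `x` and `z`. -/
def CBtw (x z y : Vtx d) : Prop := ∀ c, min (x c) (z c) ≤ y c ∧ y c ≤ max (x c) (z c)

lemma inBox_btw {n : ℕ} {x z y : Vtx d} (hx : inBox n x) (hz : inBox n z) (h : CBtw x z y) :
    inBox n y := by
  intro c
  have h1 := abs_le.1 (hx c)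
  have h2 := abs_le.1 (hz c)
  have h3 := h c
  rw [abs_le]
  omega

/-- The ℓ¹ distance. -/
def dist1 (x y : Vtx d) : ℤ := ∑ i, |x i - y i|

lemma adjV_iff {x y : Vtx d} (h : adjV x y) :
    ∃ c, |x c - y c| = 1 ∧ ∀ c', c' ≠ c → x c' = y c' := by
  unfold adjV at h
  have hex : ∃ c, x c ≠ y c := by
    by_contra hcon
    push Not at hcon
    simp [hcon] at h
  obtain ⟨c, hc⟩ := hex
  have hs := Finset.add_sum_erase Finset.univ (fun i => |x i - y i|) (Finset.mem_univ c)
  have hpos : 0 < |x c - y c| := abs_pos.2 (sub_ne_zero.2 hc)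
  have hnn : 0 ≤ ∑ i ∈ Finset.univ.erase c, |x i - y i| :=
    Finset.sum_nonneg fun i _ => abs_nonneg _
  have h0 : ∑ i ∈ Finset.univ.erase c, |x i - y i| = 0 := by omega
  refine ⟨c, by omega, ?_⟩
  intro c' hc'
  rw [Finset.sum_eq_zero_iff_of_nonneg (fun i _ => abs_nonneg _)] at h0
  have := h0 c' (by simp [hc'])
  exact sub_eq_zero.1 (abs_eq_zero.1 this)

lemma dist1_diff {x y : Vtx d} {c : Fin d} (h : ∀ c', c' ≠ c → x c' = y c') (z : Vtx d) :
    dist1 x z - dist1 y z = |x c - z c| - |y c - z c| := by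
  unfold dist1
  rw [← Finset.sum_sub_distrib]
  rw [Finset.sum_eq_single c]
  · intro c' _ hc'
    rw [h c' hc', sub_self]
  · simp

lemma adjV_of {x y : Vtx d} (c : Fin d) (h1 : |x c - y c| = 1) (h : ∀ c', c' ≠ c → x c' = y c') :
    adjV x y := by
  have := dist1_diff h y
  unfold dist1 at this
  unfold adjV
  simp at this
  omega

lemma dist1_lip {x y : Vtx d} (h : adjV x y) (z : Vtx d) : dist1 x z - dist1 y z ≤ 1 := by
  obtain ⟨c, hc, hc'⟩ := adjV_iff h
  rw [dist1_diff hc']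
  have := abs_sub_abs_le_abs_sub (x c - z c) (y c - z c)
  rw [show x c - z c - (y c - z c) = x c - y c by ring, hc] at this
  exact this

lemma reach_between {n : ℕ} {ω : Sym2 (Vtx d) → ℝ} {T Z : Vtx d} {a c0 : ℝ}
    (hZ : Reach n ω T Z c0) (hZb : inBox n Z) :
    ∀ (k : ℕ) (x : Vtx d), dist1 x Z = k → inBox n x →
      (∀ y y', CBtw x Z y → CBtw x Z y' → adjV y y' → ω s(y, y') = a) →
      Reach n ω T x (a * k + c0) := by
  intro k
  induction k with
  | zero =>
    intro x hx _ _
    have : x = Z := by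
      unfold dist1 at hx
      rw [Nat.cast_zero, Finset.sum_eq_zero_iff_of_nonneg (fun i _ => abs_nonneg _)] at hx
      funext i
      exact sub_eq_zero.1 (abs_eq_zero.1 (hx i (Finset.mem_univ i)))
    subst this
    simpa using hZ
  | succ k ih =>
    intro x hx hxb hω
    have hex : ∃ c, x c ≠ Z c := by
      by_contra hcon
      push Not at hcon
      simp [dist1, hcon] at hx
      omega
    obtain ⟨c, hc⟩ := hex
    obtain ⟨t, ht, htm, hta⟩ : ∃ t : ℤ, (min (x c) (Z c) ≤ t ∧ t ≤ max (x c) (Z c)) ∧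
        |x c - t| = 1 ∧ |x c - Z c| - |t - Z c| = 1 := by
      rcases lt_or_gt_of_ne hc with h | h
      · refine ⟨x c + 1, by omega, by simp, ?_⟩
        rw [abs_of_nonpos (by omega), abs_of_nonpos (by omega)]; ring
      · refine ⟨x c - 1, by omega, by simp, ?_⟩
        rw [abs_of_nonneg (by omega), abs_of_nonneg (by omega)]; ring
    set y : Vtx d := Function.update x c t with hy
    have hyc : y c = t := by simp [hy]
    have hyc' : ∀ c', c' ≠ c → x c' = y c' := by
      intro c' h; simp [hy, Function.update_of_ne h]
    have hadj : adjV x y := adjV_of c (by rw [hyc]; exact htm) hyc'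
    have hxbtw : CBtw x Z x := fun c => by omega
    have hybtw : CBtw x Z y := by
      intro c'
      by_cases h : c' = c
      · subst h; rw [hyc]; exact ht
      · rw [← hyc' c' h]; omega
    have hyd : dist1 y Z = k := by
      have := dist1_diff hyc' Z
      rw [hyc, hta] at this
      push_cast at hx
      omega
    have htrans : ∀ z, CBtw y Z z → CBtw x Z z := by
      intro z hz c'
      have h1 := hz c'
      have h2 := hybtw c'
      omega
    have := ih y hyd (inBox_btw hxb hZb hybtw)
      (fun z z' h1 h2 h3 => hω z z' (htrans z h1) (htrans z' h2) h3)
    refine reach_step hxb hadj this ?_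
    rw [hω x y hxbtw hybtw hadj]
    push_cast
    linarith

lemma inBox_zero (n : ℕ) : inBox n (0 : Vtx d) := by
  intro c; simp

lemma adjV_ne {x y : Vtx d} (h : adjV x y) : x ≠ y := by
  rintro rfl
  simp [adjV] at h

lemma fppT_eq_of {v : Vtx d} {n : ℕ} {ω : Sym2 (Vtx d) → ℝ} {c : ℝ} (h : Vtx d → ℝ)
    (hω : ∀ e ∈ EdgeSet d n, 0 ≤ ω e)
    (hh : ∀ x y, adjV x y → h x - h y ≤ ω s(x, y))
    (hc : h 0 - h (fun i => (n : ℤ) * v i) = c)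
    (hr : Reach n ω (fun i => (n : ℤ) * v i) 0 c) : fppT d v n ω = c := by
  obtain ⟨p, hp, hpc⟩ := hr
  apply le_antisymm
  · exact (fppT_le hω hp).trans hpc
  · apply le_fppT hp
    intro q hq
    rw [← hc]
    exact pathTime_pot h hh q hq

lemma fpp_U {v : Vtx d} {n : ℕ} {T : Vtx d} (hT : T = fun i => (n : ℤ) * v i) {a b : ℝ}
    (g : Vtx d → ℝ) (ω : Sym2 (Vtx d) → ℝ) (u w : Vtx d) (x1 x2 : ℝ)
    (hx1 : a ≤ x1 ∧ x1 ≤ b) (hx2 : a ≤ x2 ∧ x2 ≤ b) (hω : ∀ e ∈ EdgeSet d n, 0 ≤ ω e)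
    (hu : adjV 0 u) (hw : adjV 0 w)
    (e1 : ω s(0, u) = x1) (e2 : ω s(0, w) = x2)
    (e3 : ∀ y, adjV 0 y → y ≠ u → y ≠ w → ω s(0, y) = b)
    (hg : ∀ x y, x ≠ 0 → y ≠ 0 → adjV x y → g x - g y ≤ ω s(x, y))
    (hg0 : ∀ y, adjV 0 y → |g 0 - g y| ≤ a) (gT : g T = 0) (hT0 : T ≠ 0)
    (pu : Reach n ω T u (g 0 - a)) (pw : Reach n ω T w (g 0 - a)) :
    fppT d v n ω = g 0 - a + min x1 x2 := by
  classical
  have hm1 := min_le_left x1 x2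
  have hm2 := min_le_right x1 x2
  have hm3 : a ≤ min x1 x2 := le_min hx1.1 hx2.1
  have hmω : ∀ y, adjV 0 y → min x1 x2 ≤ ω s(0, y) := by
    intro y hy
    by_cases h1 : y = u
    · subst h1; linarith
    by_cases h2 : y = w
    · subst h2; linarith
    rw [e3 y hy h1 h2]; linarith [hx1.2]
  refine fppT_eq_of (fun x => if x = 0 then g 0 - a + min x1 x2 else g x) hω ?_ ?_ ?_
  · intro x y hxy
    have hne := adjV_ne hxy
    by_cases h1 : x = 0
    · subst h1
      simp only [if_true, if_neg hne.symm]
      have := abs_le.1 (hg0 y hxy)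
      linarith [hmω y hxy]
    · by_cases h2 : y = 0
      · subst h2
        simp only [if_true, if_neg hne]
        have := abs_le.1 (hg0 x (adjV_symm hxy))
        rw [Sym2.eq_swap]
        linarith [hmω x (adjV_symm hxy)]
      · simp only [if_neg h1, if_neg h2]
        exact hg x y h1 h2 hxy
  · rw [← hT]; simp [hT0, gT]
  · rw [← hT]
    rcases min_choice x1 x2 with h | h
    · exact reach_step (inBox_zero n) hu pu (by rw [h, e1]; linarith)
    · exact reach_step (inBox_zero n) hw pw (by rw [h, e2]; linarith)

lemma fpp_L {v : Vtx d} {n : ℕ} {T : Vtx d} (hT : T = fun i => (n : ℤ) * v i) {a b : ℝ}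
    (ha : 0 < a) (hab : a < b)
    (g : Vtx d → ℝ) (ω : Sym2 (Vtx d) → ℝ) (u w u' : Vtx d) (x1 x2 : ℝ)
    (hx1 : a ≤ x1 ∧ x1 ≤ b) (hx2 : a ≤ x2 ∧ x2 ≤ b) (hω : ∀ e ∈ EdgeSet d n, 0 ≤ ω e)
    (hu : adjV 0 u) (hw : adjV 0 w) (hu' : adjV u u') (hub : inBox n u)
    (huw : w ≠ u)
    (e1 : ω s(0, u) = x1) (e2 : ω s(u, u') = x2)
    (e3 : ∀ y, adjV 0 y → y ≠ u → ω s(0, y) = b)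
    (e4 : ∀ y, adjV u y → y ≠ 0 → y ≠ u' → ω s(u, y) = b)
    (hg : ∀ x y, x ≠ 0 → y ≠ 0 → x ≠ u → y ≠ u → adjV x y → g x - g y ≤ ω s(x, y))
    (hg0 : ∀ y, adjV 0 y → |g 0 - g y| ≤ a) (hgu : ∀ y, adjV u y → |g u - g y| ≤ a)
    (gu : g u = g 0 - a)
    (gT : g T = 0) (hT0 : T ≠ 0) (hTu : T ≠ u)
    (pw : Reach n ω T w (g 0 - a)) (pu' : Reach n ω T u' (g 0 - 2 * a)) :
    fppT d v n ω = g 0 - 2 * a + min (x1 + x2) (a + b) := by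
  classical
  have hm1 := min_le_left (x1 + x2) (a + b)
  have hm2 := min_le_right (x1 + x2) (a + b)
  have hm3 : 2 * a ≤ min (x1 + x2) (a + b) := le_min (by linarith) (by linarith)
  have hu0 : u ≠ 0 := (adjV_ne hu).symm
  have hmu : ∀ y, adjV u y → y ≠ 0 → x2 ≤ ω s(u, y) := by
    intro y hy h0
    by_cases h1 : y = u'
    · subst h1; linarith
    · rw [e4 y hy h0 h1]; exact hx2.2
  obtain ⟨h, hh0, hhu, hh⟩ : ∃ h : Vtx d → ℝ, h 0 = g 0 - 2 * a + min (x1 + x2) (a + b) ∧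
      h u = g u - a + x2 ∧ ∀ x, x ≠ 0 → x ≠ u → h x = g x := by
    refine ⟨fun x => if x = 0 then g 0 - 2 * a + min (x1 + x2) (a + b) else
      if x = u then g u - a + x2 else g x, by simp, by simp [hu0], ?_⟩
    intro x h1 h2
    simp [h1, h2]
  -- both directions along every edge at `0`
  have key0 : ∀ y, adjV 0 y → h 0 - h y ≤ ω s(0, y) ∧ h y - h 0 ≤ ω s(0, y) := by
    intro y hy
    have := abs_le.1 (hg0 y hy)
    by_cases h1 : y = u
    · subst h1
      rw [hh0, hhu, e1, gu]
      have : x2 ≤ min (x1 + x2) (a + b) := le_min (by linarith) (by linarith)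
      constructor <;> linarith
    · rw [hh0, hh y (adjV_ne hy).symm h1, e3 y hy h1]
      constructor <;> linarith
  have keyu : ∀ y, adjV u y → h u - h y ≤ ω s(u, y) ∧ h y - h u ≤ ω s(u, y) := by
    intro y hy
    have := abs_le.1 (hgu y hy)
    by_cases h1 : y = 0
    · subst h1
      have := key0 u hu
      rw [Sym2.eq_swap]
      exact ⟨this.2, this.1⟩
    · rw [hhu, hh y h1 (adjV_ne hy).symm]
      have := hmu y hy h1
      constructor <;> linarith
  refine fppT_eq_of h hω ?_ ?_ ?_
  · intro x y hxy
    by_cases h1 : x = 0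
    · subst h1; exact (key0 y hxy).1
    by_cases h2 : y = 0
    · subst h2; rw [Sym2.eq_swap]; exact (key0 x (adjV_symm hxy)).2
    by_cases h3 : x = u
    · subst h3; exact (keyu y hxy).1
    by_cases h4 : y = u
    · subst h4; rw [Sym2.eq_swap]; exact (keyu x (adjV_symm hxy)).2
    rw [hh x h1 h3, hh y h2 h4]
    exact hg x y h1 h2 h3 h4 hxy
  · rw [← hT, hh T hT0 hTu, hh0, gT]; ring
  · rw [← hT]
    rcases min_choice (x1 + x2) (a + b) with h | h
    · have : Reach n ω T u (g 0 - 2 * a + x2) := reach_step hub hu' pu' (by rw [e2]; linarith)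
      exact reach_step (inBox_zero n) hu this (by rw [h, e1]; linarith)
    · exact reach_step (inBox_zero n) hw pw (by rw [h, e3 w hw huw]; linarith)

/-- Abstract form of the two extremal configurations. -/
lemma exists_both {v : Vtx d} {n : ℕ} {T : Vtx d} (hT : T = fun i => (n : ℤ) * v i) {a b : ℝ}
    (ha : 0 < a) (hab : a < b)
    (g : Vtx d → ℝ) (ω0 : Sym2 (Vtx d) → ℝ) (u w u' : Vtx d)
    (hω0 : ∀ e, ω0 e = a ∨ ω0 e = b)
    (hu : adjV 0 u) (hw : adjV 0 w) (hu' : adjV u u') (hub : inBox n u)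
    (hwb : inBox n w) (hub' : inBox n u')
    (huw : w ≠ u) (hu0' : u' ≠ 0)
    (hg : ∀ x y, adjV x y → g x - g y ≤ ω0 s(x, y))
    (hg0 : ∀ y, adjV 0 y → |g 0 - g y| ≤ a) (hgu : ∀ y, adjV u y → |g u - g y| ≤ a)
    (gu : g u = g 0 - a)
    (gT : g T = 0) (hT0 : T ≠ 0) (hTu : T ≠ u)
    (pu : ∀ ω : Sym2 (Vtx d) → ℝ, (∀ x y, x ≠ 0 → y ≠ 0 → ω s(x, y) = ω0 s(x, y)) →
      Reach n ω T u (g 0 - a))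
    (pw : ∀ ω : Sym2 (Vtx d) → ℝ, (∀ x y, x ≠ 0 → y ≠ 0 → x ≠ u → y ≠ u →
      ω s(x, y) = ω0 s(x, y)) → Reach n ω T w (g 0 - a))
    (pu' : ∀ ω : Sym2 (Vtx d) → ℝ, (∀ x y, x ≠ 0 → y ≠ 0 → x ≠ u → y ≠ u →
      ω s(x, y) = ω0 s(x, y)) → Reach n ω T u' (g 0 - 2 * a)) :
    (∃ (n : ℕ) (S : Finset (Sym2 (Vtx d))) (ω : Sym2 (Vtx d) → ℝ),
       ↑S ⊆ EdgeSet d n ∧ S.card = 2 ∧ ValidEnv d n a b ω ∧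
       envDerivOn a b S (fppT d v n) ω = b - a) ∧
    (∃ (n : ℕ) (S : Finset (Sym2 (Vtx d))) (ω : Sym2 (Vtx d) → ℝ),
       ↑S ⊆ EdgeSet d n ∧ S.card = 2 ∧ ValidEnv d n a b ω ∧
       envDerivOn a b S (fppT d v n) ω = -(b - a)) := by
  have hu0 : u ≠ 0 := (adjV_ne hu).symm
  have hw0 : w ≠ 0 := (adjV_ne hw).symm
  have huu' : u ≠ u' := adjV_ne hu'
  have hnn : ∀ ω, ValidEnv d n a b ω → ∀ e ∈ EdgeSet d n, 0 ≤ ω e := by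
    intro ω hω e he
    rcases hω e he with h | h <;> rw [h] <;> linarith
  have hrange : ∀ x, (x = a ∨ x = b) → a ≤ x ∧ x ≤ b := by
    rintro x (rfl | rfl) <;> constructor <;> linarith
  constructor
  · have hne : s((0 : Vtx d), u) ≠ s(0, w) := by
      intro h
      rcases Sym2.eq_iff.1 h with h | h
      · exact huw h.2.symm
      · exact hw0 h.1.symm
    let ω : Sym2 (Vtx d) → ℝ := fun e => if (0 : Vtx d) ∈ e then b else ω0 e
    have hωv : ValidEnv d n a b ω := by
      intro e _
      by_cases h : (0 : Vtx d) ∈ e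
      · right; simp [ω, h]
      · simpa [ω, h] using hω0 e
    refine ⟨n, {s(0, u), s(0, w)}, ω, ?_, Finset.card_pair hne, hωv, ?_⟩
    · intro e he
      simp at he
      rcases he with rfl | rfl
      · exact mem_edgeSet hu (inBox_zero n) hub
      · exact mem_edgeSet hw (inBox_zero n) hwb
    · rw [envDerivOn_pair a b _ _ hne (fppT d v n) ω (fun x y => g 0 - a + min x y)]
      · simp only [min_self, min_eq_left hab.le, min_eq_right hab.le]; ring
      · intro x1 x2 hx1 hx2
        set ω' := Function.update (Function.update ω s(0, u) x1) s(0, w) x2 with hω'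
        have hv' : ValidEnv d n a b ω' :=
          validEnv_update (validEnv_update hωv _ hx1) _ hx2
        have hoff : ∀ x y, x ≠ 0 → y ≠ 0 → ω' s(x, y) = ω0 s(x, y) := by
          intro x y hx hy
          rw [hω', Function.update_of_ne, Function.update_of_ne]
          · simp [ω, hx.symm, hy.symm]
          · simp [hx, hy]
          · simp [hx, hy]
        refine fpp_U hT g ω' u w x1 x2 (hrange _ hx1) (hrange _ hx2) (hnn _ hv') hu hw
          ?_ ?_ ?_ ?_ hg0 gT hT0 (pu _ hoff) (pw _ (fun x y h1 h2 _ _ => hoff x y h1 h2))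
        · rw [hω', Function.update_of_ne hne, Function.update_self]
        · rw [hω', Function.update_self]
        · intro y hy h1 h2
          have hy0 := adjV_ne hy
          rw [hω', Function.update_of_ne, Function.update_of_ne]
          · simp [ω]
          · simp [h1, hu0.symm]
          · simp [h2, hw0.symm]
        · intro x y hx hy hxy
          rw [hoff x y hx hy]; exact hg x y hxy
  · have hne : s((0 : Vtx d), u) ≠ s(u, u') := by
      intro h
      rcases Sym2.eq_iff.1 h with h | h
      · exact hu0 h.1.symm
      · exact hu0' h.1.symm
    let ω : Sym2 (Vtx d) → ℝ := fun e => if (0 : Vtx d) ∈ e ∨ u ∈ e then b else ω0 e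
    have hωv : ValidEnv d n a b ω := by
      intro e _
      by_cases h : (0 : Vtx d) ∈ e ∨ u ∈ e
      · right; simp only [ω, if_pos h]
      · simp only [ω, if_neg h]; exact hω0 e
    refine ⟨n, {s(0, u), s(u, u')}, ω, ?_, Finset.card_pair hne, hωv, ?_⟩
    · intro e he
      simp at he
      rcases he with rfl | rfl
      · exact mem_edgeSet hu (inBox_zero n) hub
      · exact mem_edgeSet hu' hub hub'
    · rw [envDerivOn_pair a b _ _ hne (fppT d v n) ω
        (fun x y => g 0 - 2 * a + min (x + y) (a + b))]
      · simp only [min_self]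
        rw [min_eq_right (by linarith : a + b ≤ b + b), min_eq_left (by linarith : a + a ≤ a + b),
          min_eq_right (by linarith : a + b ≤ b + a)]
        ring
      · intro x1 x2 hx1 hx2
        set ω' := Function.update (Function.update ω s(0, u) x1) s(u, u') x2 with hω'
        have hv' : ValidEnv d n a b ω' :=
          validEnv_update (validEnv_update hωv _ hx1) _ hx2
        have hoff : ∀ x y, x ≠ 0 → y ≠ 0 → x ≠ u → y ≠ u → ω' s(x, y) = ω0 s(x, y) := by
          intro x y hx hy hxu hyu
          rw [hω', Function.update_of_ne, Function.update_of_ne]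
          · simp [ω, hx.symm, hy.symm, hxu.symm, hyu.symm]
          · simp [hx, hy]
          · simp [hxu, hyu]
        refine fpp_L hT ha hab g ω' u w u' x1 x2 (hrange _ hx1) (hrange _ hx2) (hnn _ hv') hu hw
          hu' hub huw ?_ ?_ ?_ ?_ ?_ hg0 hgu gu gT hT0 hTu (pw _ hoff) (pu' _ hoff)
        · rw [hω', Function.update_of_ne hne, Function.update_self]
        · rw [hω', Function.update_self]
        · intro y hy h1
          have hy0 := adjV_ne hy
          rw [hω', Function.update_of_ne, Function.update_of_ne]
          · simp [ω]
          · simp [h1, hu0.symm]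
          · simp [hu0.symm, hu0'.symm]
        · intro y hy h0 h1
          rw [hω', Function.update_of_ne, Function.update_of_ne]
          · simp [ω]
          · simp [h0, hu0]
          · simp [h1, huu']
        · intro x y hx hy hxu hyu hxy
          rw [hoff x y hx hy hxu hyu]; exact hg x y hxy

lemma reach_between' {n : ℕ} {ω : Sym2 (Vtx d) → ℝ} {T Z x : Vtx d} {a c0 c : ℝ}
    (hZ : Reach n ω T Z c0) (hZb : inBox n Z) (hx : inBox n x)
    (h : ∀ y y', CBtw x Z y → CBtw x Z y' → adjV y y' → ω s(y, y') = a)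
    (hc : a * (dist1 x Z : ℝ) + c0 = c) : Reach n ω T x c := by
  have h0 : 0 ≤ dist1 x Z := Finset.sum_nonneg fun i _ => abs_nonneg _
  obtain ⟨k, hk⟩ := Int.eq_ofNat_of_zero_le h0
  have := reach_between hZ hZb k x hk hx h
  rw [← hc, hk]
  simpa using this

lemma exists_sign {t : ℤ} (ht : t ≠ 0) : ∃ s : ℤ, (s = 1 ∧ 1 ≤ t) ∨ (s = -1 ∧ t ≤ -1) := by
  rcases lt_or_gt_of_ne ht with h | h
  · exact ⟨-1, Or.inr ⟨rfl, by omega⟩⟩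
  · exact ⟨1, Or.inl ⟨rfl, by omega⟩⟩

lemma sign_abs {s t : ℤ} (h : (s = 1 ∧ 1 ≤ t) ∨ (s = -1 ∧ t ≤ -1)) :
    |s| = 1 ∧ |0 - t| - |s - t| = 1 := by
  rcases h with ⟨rfl, h⟩ | ⟨rfl, h⟩
  · refine ⟨by simp, ?_⟩
    rw [abs_of_nonpos (by omega), abs_of_nonpos (by omega)]; ring
  · refine ⟨by simp, ?_⟩
    rw [abs_of_nonneg (by omega), abs_of_nonneg (by omega)]; ring

lemma adjV_add_single (x : Vtx d) (i : Fin d) {s : ℤ} (hs : |s| = 1) :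
    adjV x (x + Pi.single i s) := by
  refine adjV_of i (by simp [hs]) ?_
  intro c hc
  simp [Pi.single_eq_of_ne hc]

lemma inBox_target {v : Vtx d} (hv : ∀ i, |v i| ≤ 2) (n : ℕ) :
    inBox n (fun i => (n : ℤ) * v i) := by
  intro c
  simp only [abs_mul, Nat.abs_cast]
  have := hv c
  nlinarith [Int.natCast_nonneg n]

lemma inBox_single {n : ℕ} (hn : 1 ≤ n) (i : Fin d) {s : ℤ} (hs : |s| = 1) :
    inBox n (Pi.single i s : Vtx d) := by
  intro c
  by_cases h : c = i
  · subst h; simp [hs]; omega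
  · simp [Pi.single_eq_of_ne h]

lemma inBox_single2 {n : ℕ} (hn : 1 ≤ n) {i j : Fin d} (hij : i ≠ j) {s t : ℤ} (hs : |s| = 1)
    (ht : |t| = 1) : inBox n (Pi.single i s + Pi.single j t : Vtx d) := by
  intro c
  by_cases h : c = i
  · subst h; simp [hs, Pi.single_eq_of_ne hij]; omega
  · have := inBox_single hn j ht c
    simpa [Pi.single_eq_of_ne h] using this

lemma dist1_single {T : Vtx d} (x : Vtx d) (i : Fin d) (hx : x i = 0) {s : ℤ}
    (h : (s = 1 ∧ 1 ≤ T i) ∨ (s = -1 ∧ T i ≤ -1)) :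
    dist1 (x + Pi.single i s) T = dist1 x T - 1 := by
  have h1 : ∀ c, c ≠ i → x c = (x + Pi.single i s : Vtx d) c := by
    intro c hc; simp [Pi.single_eq_of_ne hc]
  have h2 := dist1_diff h1 T
  simp only [Pi.add_apply, Pi.single_eq_same, hx] at h2
  rw [show (0 : ℤ) + s = s by ring, (sign_abs h).2] at h2
  omega

lemma btw_ne_zero {T x y : Vtx d} {i : Fin d} {s : ℤ}
    (h : (s = 1 ∧ 1 ≤ T i) ∨ (s = -1 ∧ T i ≤ -1)) (hx : x i = s) (hy : CBtw x T y) :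
    y i ≠ 0 := by
  have := hy i
  omega

lemma case_A {v : Vtx d} {a b : ℝ} (ha : 0 < a) (hab : a < b) (hv : ∀ i, |v i| ≤ 2)
    {i j : Fin d} (hij : i ≠ j) (hi : v i ≠ 0) (hj : v j ≠ 0) :
    (∃ (n : ℕ) (S : Finset (Sym2 (Vtx d))) (ω : Sym2 (Vtx d) → ℝ),
       ↑S ⊆ EdgeSet d n ∧ S.card = 2 ∧ ValidEnv d n a b ω ∧
       envDerivOn a b S (fppT d v n) ω = b - a) ∧
    (∃ (n : ℕ) (S : Finset (Sym2 (Vtx d))) (ω : Sym2 (Vtx d) → ℝ),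
       ↑S ⊆ EdgeSet d n ∧ S.card = 2 ∧ ValidEnv d n a b ω ∧
       envDerivOn a b S (fppT d v n) ω = -(b - a)) := by
  obtain ⟨s, hs⟩ := exists_sign hi
  obtain ⟨t, ht⟩ := exists_sign hj
  have hs1 := (sign_abs hs).1
  have ht1 := (sign_abs ht).1
  have hs0 : s ≠ 0 := by omega
  have ht0 : t ≠ 0 := by omega
  have hT : v = fun i => ((1 : ℕ) : ℤ) * v i := by simp
  have hTb : inBox 1 v := by rw [hT]; exact inBox_target hv 1
  set u : Vtx d := Pi.single i s with hu
  set w : Vtx d := Pi.single j t with hw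
  have hui : u i = s := by simp [hu]
  have huj : u j = 0 := by simp [hu, Pi.single_eq_of_ne hij.symm]
  have hwi : w i = 0 := by simp [hw, Pi.single_eq_of_ne hij]
  have hwj : w j = t := by simp [hw]
  have hlip : ∀ x y : Vtx d, adjV x y → a * (dist1 x v : ℝ) - a * dist1 y v ≤ a := by
    intro x y hxy
    have h1 : ((dist1 x v : ℤ) : ℝ) - dist1 y v ≤ 1 := by exact_mod_cast dist1_lip hxy v
    nlinarith
  have hlip' : ∀ x y : Vtx d, adjV x y → |a * (dist1 x v : ℝ) - a * dist1 y v| ≤ a := by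
    intro x y hxy
    rw [abs_le]
    constructor <;> linarith [hlip x y hxy, hlip y x (adjV_symm hxy)]
  have du : dist1 u v = dist1 0 v - 1 := by
    have := dist1_single (T := v) 0 i rfl hs
    rwa [zero_add] at this
  have dw : dist1 w v = dist1 0 v - 1 := by
    have := dist1_single (T := v) 0 j rfl ht
    rwa [zero_add] at this
  have du' : dist1 (u + w) v = dist1 0 v - 2 := by
    have := dist1_single (T := v) u j huj ht
    rw [this, du]; ring
  have hub : inBox 1 u := inBox_single le_rfl i hs1
  have hwb : inBox 1 w := inBox_single le_rfl j ht1
  have hub' : inBox 1 (u + w) := inBox_single2 le_rfl hij hs1 ht1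
  refine exists_both hT ha hab (fun x => a * (dist1 x v : ℝ)) (fun _ => a) u w (u + w)
    (fun _ => Or.inl rfl) ?_ ?_ (adjV_add_single u j ht1) hub hwb hub' ?_ ?_ hlip
    (hlip' 0) (hlip' u) ?_ ?_ ?_ ?_ ?_ ?_ ?_
  · simpa using adjV_add_single (0 : Vtx d) i hs1
  · simpa using adjV_add_single (0 : Vtx d) j ht1
  · intro h
    have := congrFun h i
    rw [hwi, hui] at this
    exact hs0 this.symm
  · intro h
    have := congrFun h i
    simp [hwi, hui] at this
    exact hs0 this
  · simp only [du]; push_cast; ring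
  · simp [dist1]
  · intro h; exact hi (congrFun h i)
  · intro h
    have := congrFun h j
    rw [huj] at this
    exact hj this
  · intro ω hω
    refine reach_between' (a := a) (reach_refl hTb) hTb hub ?_ (by rw [du]; push_cast; ring : _ = _)
    intro y y' h1 h2 _
    rw [hω]
    · intro h; exact btw_ne_zero hs hui h1 (congrFun h i)
    · intro h; exact btw_ne_zero hs hui h2 (congrFun h i)
  · intro ω hω
    refine reach_between' (a := a) (reach_refl hTb) hTb hwb ?_ (by rw [dw]; push_cast; ring : _ = _)
    intro y y' h1 h2 _
    have n1 := btw_ne_zero ht hwj h1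
    have n2 := btw_ne_zero ht hwj h2
    rw [hω]
    · intro h; exact n1 (congrFun h j)
    · intro h; exact n2 (congrFun h j)
    · intro h; exact n1 ((congrFun h j).trans huj)
    · intro h; exact n2 ((congrFun h j).trans huj)
  · intro ω hω
    refine reach_between' (a := a) (reach_refl hTb) hTb hub' ?_ (by rw [du']; push_cast; ring : _ = _)
    intro y y' h1 h2 _
    have hj' : (u + w) j = t := by simp [huj, hwj]
    have n1 := btw_ne_zero ht hj' h1
    have n2 := btw_ne_zero ht hj' h2
    rw [hω]
    · intro h; exact n1 (congrFun h j)
    · intro h; exact n2 (congrFun h j)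
    · intro h; exact n1 ((congrFun h j).trans huj)
    · intro h; exact n2 ((congrFun h j).trans huj)

lemma dist1_axis {i c : Fin d} {T x y : Vtx d} (hT : ∀ c, c ≠ i → T c = 0)
    (hx : ∀ c, c ≠ i → x c = 0) (hc : |x c - y c| = 1) (hci : c ≠ i)
    (h : ∀ c', c' ≠ c → x c' = y c') : dist1 y T = dist1 x T + 1 := by
  have h1 := dist1_diff h T
  rw [hT c hci, hx c hci] at h1
  rw [hx c hci] at hc
  simp at h1 hc
  omega

set_option maxHeartbeats 2000000 in
lemma case_B {v : Vtx d} {a b : ℝ} (ha : 0 < a) (hab : a < b) (hv : ∀ i, |v i| ≤ 2)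
    {i j k : Fin d} (hji : j ≠ i) (hki : k ≠ i) (hkj : k ≠ j) (hi : v i ≠ 0)
    (hvc : ∀ c, c ≠ i → v c = 0) :
    (∃ (n : ℕ) (S : Finset (Sym2 (Vtx d))) (ω : Sym2 (Vtx d) → ℝ),
       ↑S ⊆ EdgeSet d n ∧ S.card = 2 ∧ ValidEnv d n a b ω ∧
       envDerivOn a b S (fppT d v n) ω = b - a) ∧
    (∃ (n : ℕ) (S : Finset (Sym2 (Vtx d))) (ω : Sym2 (Vtx d) → ℝ),
       ↑S ⊆ EdgeSet d n ∧ S.card = 2 ∧ ValidEnv d n a b ω ∧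
       envDerivOn a b S (fppT d v n) ω = -(b - a)) := by
  classical
  obtain ⟨m, hm⟩ := exists_nat_gt (2 * a / (b - a))
  have hba : 0 < b - a := by linarith
  rw [div_lt_iff₀ hba] at hm
  set n : ℕ := m + 1 with hn
  have hn1 : 1 ≤ n := by omega
  obtain ⟨T, hT⟩ : ∃ T : Vtx d, T = fun i => (n : ℤ) * v i := ⟨_, rfl⟩
  have hTb : inBox n T := by rw [hT]; exact inBox_target hv n
  have hTc : ∀ c, c ≠ i → T c = 0 := by
    intro c hc; rw [hT]; simp [hvc c hc]
  have hTi : (m : ℤ) + 1 ≤ |T i| := by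
    rw [hT]
    simp only [abs_mul, Nat.abs_cast]
    have : 1 ≤ |v i| := Int.one_le_abs hi
    rw [hn]; push_cast
    nlinarith [Int.natCast_nonneg m]
  have hTi0 : T i ≠ 0 := by
    intro h; rw [h] at hTi; simp at hTi; omega
  obtain ⟨s, hs⟩ := exists_sign hTi0
  have hs1 := (sign_abs hs).1
  have hs0 : s ≠ 0 := by omega
  have h11 : |(1 : ℤ)| = 1 := by simp
  set u : Vtx d := Pi.single j 1 with hu
  set w : Vtx d := Pi.single k 1 with hw
  have huj : u j = 1 := by simp [hu]
  have hui : u i = 0 := by simp [hu, Pi.single_eq_of_ne hji.symm]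
  have huk : u k = 0 := by simp [hu, Pi.single_eq_of_ne hkj]
  have hwk : w k = 1 := by simp [hw]
  have hub : inBox n u := inBox_single hn1 j h11
  have hwb : inBox n w := inBox_single hn1 k h11
  have hub' : inBox n (u + Pi.single i s) := inBox_single2 hn1 hji h11 hs1
  -- the axis, the environment and the potential
  let Ax : Vtx d → Prop := fun x => ∀ c, c ≠ i → x c = 0
  obtain ⟨β, hβ1, hβ2⟩ : ∃ β : Vtx d → ℝ,
      (∀ x, Ax x → β x = min ((b - a) * (|x i - T i| : ℤ)) (2 * a)) ∧
      (∀ x, ¬ Ax x → β x = 0) :=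
    ⟨fun x => if Ax x then min ((b - a) * (|x i - T i| : ℤ)) (2 * a) else 0,
      fun x hx => if_pos hx, fun x hx => if_neg hx⟩
  obtain ⟨ω0, hω1, hω2⟩ : ∃ ω0 : Sym2 (Vtx d) → ℝ, (∀ e, (∀ x ∈ e, Ax x) → ω0 e = b) ∧
      (∀ e, ¬ (∀ x ∈ e, Ax x) → ω0 e = a) :=
    ⟨fun e => if ∀ x ∈ e, Ax x then b else a, fun x hx => if_pos hx, fun x hx => if_neg hx⟩
  have hω2' : ∀ x y, ¬ Ax x → ω0 s(x, y) = a := by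
    intro x y hx
    apply hω2
    intro h
    exact hx (h x (by simp))
  have hβnn : ∀ x, 0 ≤ β x ∧ β x ≤ 2 * a := by
    intro x
    by_cases hx : Ax x
    · rw [hβ1 x hx]
      refine ⟨le_min (mul_nonneg hba.le ?_) (by linarith), min_le_right _ _⟩
      exact_mod_cast abs_nonneg _
    · rw [hβ2 x hx]; constructor <;> linarith
  have hlip : ∀ x y : Vtx d, adjV x y → a * (dist1 x T : ℝ) - a * dist1 y T ≤ a := by
    intro x y hxy
    have h1 : ((dist1 x T : ℤ) : ℝ) - dist1 y T ≤ 1 := by exact_mod_cast dist1_lip hxy T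
    nlinarith
  let g : Vtx d → ℝ := fun x => a * (dist1 x T : ℝ) + β x
  have hgdef : ∀ x, g x = a * (dist1 x T : ℝ) + β x := fun x => rfl
  have hmix : ∀ x y : Vtx d, adjV x y → Ax x → ¬ Ax y → |g x - g y| ≤ a := by
    intro x y hxy hx hy
    obtain ⟨c, hc, hc'⟩ := adjV_iff hxy
    have hci : c ≠ i := by
      rintro rfl
      apply hy
      intro c' h
      rw [← hc' c' h]; exact hx c' h
    have hd := dist1_axis hTc hx hc hci hc'
    rw [hgdef, hgdef, hβ2 y hy, hd, abs_le]
    push_cast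
    have := hβnn x
    constructor <;> linarith
  have hoffax : ∀ x y : Vtx d, adjV x y → ¬ (Ax x ∧ Ax y) → |g x - g y| ≤ a := by
    intro x y hxy hn
    by_cases hx : Ax x
    · exact hmix x y hxy hx (fun h => hn ⟨hx, h⟩)
    · by_cases hy : Ax y
      · rw [abs_sub_comm]; exact hmix y x (adjV_symm hxy) hy hx
      · rw [hgdef, hgdef, hβ2 x hx, hβ2 y hy, abs_le]
        constructor <;> linarith [hlip x y hxy, hlip y x (adjV_symm hxy)]
  have hax0 : Ax 0 := fun c _ => rfl
  have hβ0 : ∀ y, Ax y → |T i| - 1 ≤ |y i - T i| → β y = 2 * a := by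
    intro y hy h
    rw [hβ1 y hy]
    apply min_eq_right
    have h2 : (m : ℤ) ≤ |y i - T i| := by omega
    have h3 : (m : ℝ) ≤ (|y i - T i| : ℤ) := by exact_mod_cast h2
    nlinarith
  have hβz : β 0 = 2 * a := hβ0 0 hax0 (by simp)
  have haxu : ¬ Ax u := by
    intro h; have := h j hji; omega
  have hg0 : ∀ y, adjV 0 y → |g 0 - g y| ≤ a := by
    intro y hy
    by_cases h : Ax y
    · have h1 : β y = 2 * a := by
        apply hβ0 y h
        obtain ⟨c, hc, hc'⟩ := adjV_iff hy
        by_cases hci : c = i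
        · subst hci
          simp at hc
          have := abs_sub_abs_le_abs_sub (T c) (y c)
          rw [abs_sub_comm (T c)] at this
          omega
        · rw [← hc' i (Ne.symm hci)]; simp
      rw [hgdef, hgdef, hβz, h1, abs_le]
      constructor <;> linarith [hlip 0 y hy, hlip y 0 (adjV_symm hy)]
    · exact hoffax 0 y hy (fun h' => h h'.2)
  have hg : ∀ x y, adjV x y → g x - g y ≤ ω0 s(x, y) := by
    intro x y hxy
    by_cases hxy' : Ax x ∧ Ax y
    · obtain ⟨hx, hy⟩ := hxy'
      rw [hω1 _ (by intro z hz; rcases Sym2.mem_iff.1 hz with rfl | rfl <;> assumption)]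
      have h1 : |x i - T i| ≤ |y i - T i| + 1 := by
        obtain ⟨c, hc, hc'⟩ := adjV_iff hxy
        by_cases hci : c = i
        · subst hci
          have := abs_sub_abs_le_abs_sub (x c - T c) (y c - T c)
          rw [show x c - T c - (y c - T c) = x c - y c by ring, hc] at this
          omega
        · rw [← hc' i (Ne.symm hci)]; omega
      have h2 : ((|x i - T i| : ℤ) : ℝ) ≤ (|y i - T i| : ℤ) + 1 := by exact_mod_cast h1
      have h3 : β x ≤ β y + (b - a) := by
        rw [hβ1 x hx, hβ1 y hy]
        rcases min_choice ((b - a) * ((|y i - T i| : ℤ) : ℝ)) (2 * a) with h | h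
        · rw [h]
          refine (min_le_left _ _).trans ?_
          nlinarith
        · rw [h]
          refine (min_le_right _ _).trans ?_
          linarith
      rw [hgdef, hgdef]
      linarith [hlip x y hxy]
    · rw [hω2 _ (by intro h; exact hxy' ⟨h x (by simp), h y (by simp)⟩)]
      exact (le_abs_self _).trans (hoffax x y hxy hxy')
  -- paths running parallel to the axis
  have hpar : ∀ (l : Fin d) (x : Vtx d) (ω : Sym2 (Vtx d) → ℝ), l ≠ i → inBox n x → x l = 1 →
      (∀ y y', CBtw x (T + Pi.single l 1) y → CBtw x (T + Pi.single l 1) y' → adjV y y' →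
        ω s(y, y') = ω0 s(y, y')) →
      ω s(T + Pi.single l 1, T) = ω0 s(T + Pi.single l 1, T) → ∀ c : ℝ,
      a * (dist1 x (T + Pi.single l 1) : ℝ) + a = c → Reach n ω T x c := by
    intro l x ω hl hxb hxl hω hωT c hc
    have hZl : (T + Pi.single l 1 : Vtx d) l = 1 := by simp [hTc l hl]
    have hZb : inBox n (T + Pi.single l 1 : Vtx d) := by
      intro c
      by_cases h : c = l
      · subst h; rw [hZl]; simp; omega
      · simp [Pi.single_eq_of_ne h]; exact hTb c
    have hZ : Reach n ω T (T + Pi.single l 1) a := by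
      refine reach_step hZb (adjV_symm (adjV_add_single T l h11)) (reach_refl hTb) ?_
      rw [hωT, hω2']
      · linarith
      · intro h; have := h l hl; omega
    refine reach_between' (a := a) hZ hZb hxb ?_ hc
    intro y y' h1 h2 h3
    rw [hω y y' h1 h2 h3, hω2']
    intro h
    have h4 := h l hl
    have h5 := h1 l
    omega
  have hTl : ∀ l : Fin d, l ≠ i → ((T + Pi.single l 1 : Vtx d)) i = T i := by
    intro l hl; simp [Pi.single_eq_of_ne hl.symm]
  have hsh : ∀ (l : Fin d) (x : Vtx d), dist1 (x + Pi.single l 1) (T + Pi.single l 1) = dist1 x T := by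
    intro l x
    unfold dist1
    refine Finset.sum_congr rfl fun c _ => ?_
    simp
  have hT0 : T ≠ 0 := fun h => hTi0 (congrFun h i)
  have hTu : T ≠ u := fun h => hTi0 ((congrFun h i).trans hui)
  have hg0v : g 0 = a * (dist1 0 T : ℝ) + 2 * a := by rw [hgdef, hβz]
  have hdu : dist1 u (T + Pi.single j 1) = dist1 0 T := by
    have := hsh j 0
    rwa [zero_add] at this
  have hdw : dist1 w (T + Pi.single k 1) = dist1 0 T := by
    have := hsh k 0
    rwa [zero_add] at this
  have hdu' : dist1 (u + Pi.single i s) (T + Pi.single j 1) = dist1 0 T - 1 := by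
    have h1 := hsh j (Pi.single i s)
    have h2 := dist1_single (T := T) 0 i rfl hs
    rw [zero_add] at h2
    rw [add_comm, h2] at h1
    exact h1
  have hduT : dist1 u T = dist1 0 T + 1 := by
    refine dist1_axis (c := j) hTc hax0 (by simp [huj]) hji ?_
    intro c hc; simp [hu, Pi.single_eq_of_ne hc]
  refine exists_both hT ha hab g ω0 u w (u + Pi.single i s) ?_ ?_ ?_
    (adjV_add_single u i hs1) hub hwb hub' ?_ ?_ hg
    hg0 ?_ ?_ ?_ hT0 hTu ?_ ?_ ?_
  · intro e
    by_cases h : ∀ x ∈ e, Ax x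
    · right; exact hω1 e h
    · left; exact hω2 e h
  · simpa using adjV_add_single (0 : Vtx d) j h11
  · simpa using adjV_add_single (0 : Vtx d) k h11
  · intro h
    have := congrFun h k
    omega
  · intro h
    have := congrFun h i
    simp [hui] at this
    exact hs0 this
  · intro y hy
    exact hoffax u y hy (fun h => haxu h.1)
  · rw [hg0v, hgdef, hβ2 u haxu, hduT]; push_cast; ring
  · rw [hgdef, hβ1 T hTc]
    simp [dist1, ha.le]
  · intro ω hω
    refine hpar j u ω hji hub huj ?_ ?_ _ ?_
    · intro y y' h1 h2 _
      apply hω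
      · intro h; have h3 := h1 j; have h4 := congrFun h j
        simp [huj, hTc j hji] at h3 h4; omega
      · intro h; have h3 := h2 j; have h4 := congrFun h j
        simp [huj, hTc j hji] at h3 h4; omega
    · apply hω _ _ _ hT0
      intro h; exact hTi0 ((hTl j hji).symm.trans (congrFun h i))
    · rw [hdu, hg0v]; ring
  · intro ω hω
    have key : ∀ y, CBtw w (T + Pi.single k 1) y → y k ≠ 0 := by
      intro y h1 h; have h3 := h1 k
      simp [hwk, hTc k hki] at h3; omega
    refine hpar k w ω hki hwb hwk ?_ ?_ _ ?_
    · intro y y' h1 h2 _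
      apply hω
      · intro h; exact key y h1 (congrFun h k)
      · intro h; exact key y' h2 (congrFun h k)
      · intro h; exact key y h1 ((congrFun h k).trans huk)
      · intro h; exact key y' h2 ((congrFun h k).trans huk)
    · apply hω _ _ _ hT0 _ hTu
      · intro h; exact hTi0 ((hTl k hki).symm.trans (congrFun h i))
      · intro h; exact hTi0 ((hTl k hki).symm.trans ((congrFun h i).trans hui))
    · rw [hdw, hg0v]; ring
  · intro ω hω
    have hi' : (u + Pi.single i s : Vtx d) i = s := by simp [hui]
    have hs' : (s = 1 ∧ 1 ≤ (T + Pi.single j 1 : Vtx d) i) ∨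
        (s = -1 ∧ (T + Pi.single j 1 : Vtx d) i ≤ -1) := by rw [hTl j hji]; exact hs
    refine hpar j _ ω hji hub' (by simp [huj, Pi.single_eq_of_ne hji]) ?_ ?_ _ ?_
    · intro y y' h1 h2 _
      have n1 := btw_ne_zero hs' hi' h1
      have n2 := btw_ne_zero hs' hi' h2
      apply hω
      · intro h; exact n1 (congrFun h i)
      · intro h; exact n2 (congrFun h i)
      · intro h; exact n1 ((congrFun h i).trans hui)
      · intro h; exact n2 ((congrFun h i).trans hui)
    · apply hω _ _ _ hT0 _ hTu
      · intro h; exact hTi0 ((hTl j hji).symm.trans (congrFun h i))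
      · intro h; exact hTi0 ((hTl j hji).symm.trans ((congrFun h i).trans hui))
    · rw [hdu', hg0v]; push_cast; ring

end helpers

/--
In dimensions `d ≥ 3`, the second-order extremal values satisfy `U₂ = 1`
and `L₂ = −1`: for every `n`, every `S ⊆ W_n` with `|S| = 2`, and every `ω ∈ Ω_n` one has
`−(b−a) ≤ ∂_S f_n(ω) ≤ b−a`; moreover there exist `n`, `S` with `|S| = 2`, and `ω` with
`∂_S f_n(ω) = b−a`, and there exist `n`, `S` with `|S| = 2`, and `ω` with
`∂_S f_n(ω) = −(b−a)`.
-/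
theorem extremal_second_deriv_values (d : ℕ) (hd : 3 ≤ d) (a b : ℝ) (ha : 0 < a)
    (hab : a < b) (v : Vtx d) (hv : ∀ i, |v i| ≤ 2) (hv0 : v ≠ 0) :
    (∀ (n : ℕ) (S : Finset (Sym2 (Vtx d))), ↑S ⊆ EdgeSet d n → S.card = 2 →
      ∀ ω : Sym2 (Vtx d) → ℝ, ValidEnv d n a b ω →
        -(b - a) ≤ envDerivOn a b S (fppT d v n) ω ∧
        envDerivOn a b S (fppT d v n) ω ≤ b - a) ∧
    (∃ (n : ℕ) (S : Finset (Sym2 (Vtx d))) (ω : Sym2 (Vtx d) → ℝ),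
       ↑S ⊆ EdgeSet d n ∧ S.card = 2 ∧ ValidEnv d n a b ω ∧
       envDerivOn a b S (fppT d v n) ω = b - a) ∧
    (∃ (n : ℕ) (S : Finset (Sym2 (Vtx d))) (ω : Sym2 (Vtx d) → ℝ),
       ↑S ⊆ EdgeSet d n ∧ S.card = 2 ∧ ValidEnv d n a b ω ∧
       envDerivOn a b S (fppT d v n) ω = -(b - a)) := by
  refine ⟨fun n S _ hS ω hω => second_deriv_bound ha hab S hS hω, ?_⟩
  obtain ⟨i, hi⟩ : ∃ i, v i ≠ 0 := Function.ne_iff.1 hv0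
  by_cases h : ∃ j, i ≠ j ∧ v j ≠ 0
  · obtain ⟨j, hij, hj⟩ := h
    exact case_A ha hab hv hij hi hj
  · push Not at h
    obtain ⟨j, hj⟩ : ∃ j, j ∉ ({i} : Finset (Fin d)) := by
      by_contra hcon
      push Not at hcon
      have h1 := Finset.card_le_card (fun x _ => hcon x : (Finset.univ : Finset (Fin d)) ⊆ {i})
      simp at h1
      omega
    obtain ⟨k, hk⟩ : ∃ k, k ∉ ({i, j} : Finset (Fin d)) := by
      by_contra hcon
      push Not at hcon
      have h1 := Finset.card_le_card (fun x _ => hcon x : (Finset.univ : Finset (Fin d)) ⊆ {i, j})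
      have h2 := Finset.card_le_two (a := i) (b := j)
      simp at h1
      omega
    simp at hj hk
    exact case_B ha hab hv hj hk.1 hk.2 hi (fun c hc => h c (Ne.symm hc))

end
end

section
/- In dimensions d ≥ 3, the third-order extremal values satisfy U_3 = 1 and L_3 = −1. That is: for every n, every S ⊆ W_n with |S| = 3, and every ω ∈ Ω_n one has −(b−a) ≤ ∂_S f_n(ω) ≤ b−a; moreover there exist n, S with |S| = 3, and ω with ∂_S f_n(ω) = b−a, and there exist n, S with |S| = 3, and ω with ∂_S f_n(ω) = −(b−a). -/
noncomputable section

/-! ### Weighted walks in a general graph -/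

/-- Passage time of a walk. -/
def wt {V : Type*} {G : SimpleGraph V} (ω : Sym2 V → ℝ) {u w : V} (p : G.Walk u w) : ℝ :=
  (p.edges.map ω).sum

/-- First-passage time in a general graph. -/
def gT {V : Type*} (G : SimpleGraph V) (u w : V) (ω : Sym2 V → ℝ) : ℝ :=
  sInf (Set.range fun p : G.Walk u w => wt ω p)

/-- Environment raised to `b` on `B`. -/
def raise {E : Type*} [DecidableEq E] (ω : E → ℝ) (b : ℝ) (B : Finset E) : E → ℝ :=
  fun e => if e ∈ B then b else ω e

section Walks
variable {V : Type*} {G : SimpleGraph V}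

lemma wt_nil (ω : Sym2 V → ℝ) (u : V) : wt ω (SimpleGraph.Walk.nil : G.Walk u u) = 0 := by
  simp [wt]

lemma wt_cons (ω : Sym2 V → ℝ) {u x w : V} (h : G.Adj u x) (p : G.Walk x w) :
    wt ω (SimpleGraph.Walk.cons h p) = ω s(u, x) + wt ω p := by
  simp [wt]

lemma wt_append (ω : Sym2 V → ℝ) {u x w : V} (p : G.Walk u x) (q : G.Walk x w) :
    wt ω (p.append q) = wt ω p + wt ω q := by
  simp [wt, SimpleGraph.Walk.edges_append]

lemma wt_congr {ω ω' : Sym2 V → ℝ} {u w : V} (p : G.Walk u w)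
    (h : ∀ e ∈ p.edges, ω e = ω' e) : wt ω p = wt ω' p := by
  unfold wt
  rw [List.map_congr_left h]

lemma wt_mono {ω ω' : Sym2 V → ℝ} {u w : V} (p : G.Walk u w)
    (h : ∀ e ∈ p.edges, ω e ≤ ω' e) : wt ω p ≤ wt ω' p :=
  List.sum_le_sum h

lemma wt_nonneg {ω : Sym2 V → ℝ} {u w : V} (p : G.Walk u w)
    (h : ∀ e ∈ G.edgeSet, 0 ≤ ω e) : 0 ≤ wt ω p := by
  apply List.sum_nonneg
  intro x hx
  obtain ⟨e, he, rfl⟩ := List.mem_map.1 hx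
  exact h e (p.edges_subset_edgeSet he)

lemma gT_le {ω : Sym2 V → ℝ} (h : ∀ e ∈ G.edgeSet, 0 ≤ ω e) {u w : V} (p : G.Walk u w) :
    gT G u w ω ≤ wt ω p := by
  apply csInf_le
  · refine ⟨0, ?_⟩
    rintro _ ⟨q, rfl⟩
    exact wt_nonneg q h
  · exact ⟨p, rfl⟩

lemma le_gT {ω : Sym2 V → ℝ} {u w : V} (p : G.Walk u w) {t : ℝ}
    (h : ∀ q : G.Walk u w, t ≤ wt ω q) : t ≤ gT G u w ω := by
  apply le_csInf
  · exact ⟨_, ⟨p, rfl⟩⟩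
  · rintro _ ⟨q, rfl⟩
    exact h q

lemma exists_near {ω : Sym2 V → ℝ} (h : ∀ e ∈ G.edgeSet, 0 ≤ ω e) {u w : V}
    (p0 : G.Walk u w) {ε : ℝ} (hε : 0 < ε) :
    ∃ p : G.Walk u w, p.IsPath ∧ wt ω p ≤ gT G u w ω + ε := by
  classical
  obtain ⟨_, ⟨p, rfl⟩, hp⟩ := exists_lt_of_csInf_lt (s := Set.range fun p : G.Walk u w => wt ω p)
    ⟨_, ⟨p0, rfl⟩⟩ (b := gT G u w ω + ε) (by unfold gT; linarith)
  refine ⟨p.bypass, p.bypass_isPath, le_trans ?_ hp.le⟩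
  have hs := (p.edges_bypass_sublist_edges).map ω
  refine List.Sublist.sum_le_sum hs ?_
  intro x hx
  obtain ⟨e, he, rfl⟩ := List.mem_map.1 hx
  exact h e (p.edges_subset_edgeSet he)

/-- `e` comes before `e'` along `p`. -/
def Bef {u w : V} (p : G.Walk u w) (e e' : Sym2 V) : Prop :=
  (∀ x ∈ e, ∃ (p1 : G.Walk u x) (p2 : G.Walk x w), p = p1.append p2 ∧ e' ∉ p1.edges) ∧
  (∀ x ∈ e', ∃ (p1 : G.Walk u x) (p2 : G.Walk x w), p = p1.append p2 ∧ e ∉ p2.edges)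

lemma exists_split {u w : V} (p : G.Walk u w) {e : Sym2 V} (he : e ∈ p.edges) {x : V}
    (hx : x ∈ e) : ∃ (p1 : G.Walk u x) (p2 : G.Walk x w), p = p1.append p2 := by
  classical
  induction e with
  | _ y z =>
    have hxs : x ∈ p.support := by
      rcases Sym2.mem_iff.1 hx with rfl | rfl
      · exact p.fst_mem_support_of_mem_edges he
      · exact p.snd_mem_support_of_mem_edges he
    exact ⟨p.takeUntil x hxs, p.dropUntil x hxs, (p.take_spec hxs).symm⟩

lemma bef_head {u y w : V} (h : G.Adj u y) (q : G.Walk y w) {e' : Sym2 V}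
    (hn : s(u, y) ∉ q.edges) (he' : e' ∈ q.edges) :
    Bef (SimpleGraph.Walk.cons h q) s(u, y) e' := by
  have hne : e' ≠ s(u, y) := fun hh => hn (hh ▸ he')
  constructor
  · intro x hx
    rcases Sym2.mem_iff.1 hx with rfl | rfl
    · exact ⟨SimpleGraph.Walk.nil, SimpleGraph.Walk.cons h q, rfl, by simp⟩
    · exact ⟨SimpleGraph.Walk.cons h SimpleGraph.Walk.nil, q, rfl, by simpa using hne⟩
  · intro x hx
    obtain ⟨q1, q2, hq⟩ := exists_split q he' hx
    refine ⟨SimpleGraph.Walk.cons h q1, q2, by rw [hq]; rfl, fun hh => hn ?_⟩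
    rw [hq, SimpleGraph.Walk.edges_append]
    exact List.mem_append_right _ hh

lemma bef_cons {u y w : V} (h : G.Adj u y) (q : G.Walk y w) {e e' : Sym2 V}
    (hne : e' ≠ s(u, y)) (hb : Bef q e e') :
    Bef (SimpleGraph.Walk.cons h q) e e' := by
  constructor
  · intro x hx
    obtain ⟨q1, q2, hq, hn⟩ := hb.1 x hx
    exact ⟨SimpleGraph.Walk.cons h q1, q2, by rw [hq]; rfl, by simp [hne, hn]⟩
  · intro x hx
    obtain ⟨q1, q2, hq, hn⟩ := hb.2 x hx
    exact ⟨SimpleGraph.Walk.cons h q1, q2, by rw [hq]; rfl, hn⟩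

lemma bef_total {u w : V} (p : G.Walk u w) (hp : p.edges.Nodup) {e e' : Sym2 V}
    (he : e ∈ p.edges) (he' : e' ∈ p.edges) (hne : e ≠ e') : Bef p e e' ∨ Bef p e' e := by
  induction p with
  | nil => simp at he
  | cons h q ih =>
    rw [SimpleGraph.Walk.edges_cons] at hp he he'
    rw [List.nodup_cons] at hp
    rcases List.mem_cons.1 he with rfl | he
    · rcases List.mem_cons.1 he' with rfl | he'
      · exact absurd rfl hne
      · exact Or.inl (bef_head h q hp.1 he')
    · rcases List.mem_cons.1 he' with rfl | he'
      · exact Or.inr (bef_head h q hp.1 he)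
      · rcases ih hp.2 he he' with hb | hb
        · exact Or.inl (bef_cons h q (fun hh => hp.1 (hh ▸ he')) hb)
        · exact Or.inr (bef_cons h q (fun hh => hp.1 (hh ▸ he)) hb)

/-- `j` lies between `i` and `k` along `p`. -/
def Mid {u w : V} (p : G.Walk u w) (i j k : Sym2 V) : Prop :=
  ∃ x ∈ j, ∃ (p1 : G.Walk u x) (p2 : G.Walk x w), p = p1.append p2 ∧ k ∉ p1.edges ∧ i ∉ p2.edges

lemma mid_head {u y w : V} (h : G.Adj u y) (q : G.Walk y w) {j k : Sym2 V}
    (hn : s(u, y) ∉ q.edges) (hq : q.edges.Nodup) (hj : j ∈ q.edges) (hk : k ∈ q.edges)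
    (hjk : j ≠ k) :
    Mid (SimpleGraph.Walk.cons h q) s(u, y) j k ∨ Mid (SimpleGraph.Walk.cons h q) s(u, y) k j := by
  have key : ∀ {j k : Sym2 V}, j ∈ q.edges → k ∈ q.edges → Bef q j k →
      Mid (SimpleGraph.Walk.cons h q) s(u, y) j k := by
    intro j k hj hk hb
    obtain ⟨x, hx⟩ : ∃ x, x ∈ j := by
      induction j with
      | _ a b => exact ⟨a, Sym2.mem_mk_left a b⟩
    obtain ⟨q1, q2, hqq, hkk⟩ := hb.1 x hx
    refine ⟨x, hx, SimpleGraph.Walk.cons h q1, q2, by rw [hqq]; rfl, ?_, fun hh => hn ?_⟩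
    · have : k ≠ s(u, y) := fun hh => hn (hh ▸ hk)
      simp [this, hkk]
    · rw [hqq, SimpleGraph.Walk.edges_append]
      exact List.mem_append_right _ hh
  rcases bef_total q hq hj hk hjk with hb | hb
  · exact Or.inl (key hj hk hb)
  · exact Or.inr (key hk hj hb)

lemma mid_cons {u y w : V} (h : G.Adj u y) (q : G.Walk y w) {i j k : Sym2 V}
    (hne : k ≠ s(u, y)) (hb : Mid q i j k) :
    Mid (SimpleGraph.Walk.cons h q) i j k := by
  obtain ⟨x, hx, q1, q2, hq, hk, hi⟩ := hb
  exact ⟨x, hx, SimpleGraph.Walk.cons h q1, q2, by rw [hq]; rfl, by simp [hne, hk], hi⟩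

lemma mid_total {u w : V} (p : G.Walk u w) (hp : p.edges.Nodup) {i j k : Sym2 V}
    (hi : i ∈ p.edges) (hj : j ∈ p.edges) (hk : k ∈ p.edges)
    (hij : i ≠ j) (hik : i ≠ k) (hjk : j ≠ k) :
    (Mid p i j k ∨ Mid p i k j) ∨ (Mid p j i k ∨ Mid p j k i) ∨ (Mid p k i j ∨ Mid p k j i) := by
  induction p with
  | nil => simp at hi
  | cons h q ih =>
    rw [SimpleGraph.Walk.edges_cons] at hp hi hj hk
    rw [List.nodup_cons] at hp
    obtain ⟨hn, hq⟩ := hp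
    rename_i x y z
    by_cases h1 : i = s(x, y)
    · subst h1
      exact Or.inl (mid_head h q hn hq (List.mem_of_ne_of_mem hij.symm hj)
        (List.mem_of_ne_of_mem hik.symm hk) hjk)
    by_cases h2 : j = s(x, y)
    · subst h2
      exact Or.inr (Or.inl (mid_head h q hn hq (List.mem_of_ne_of_mem hij hi)
        (List.mem_of_ne_of_mem hjk.symm hk) hik))
    by_cases h3 : k = s(x, y)
    · subst h3
      exact Or.inr (Or.inr (mid_head h q hn hq (List.mem_of_ne_of_mem hik hi)
        (List.mem_of_ne_of_mem hjk hj) hij))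
    rcases ih hq (List.mem_of_ne_of_mem h1 hi) (List.mem_of_ne_of_mem h2 hj)
      (List.mem_of_ne_of_mem h3 hk) with (hm | hm) | (hm | hm) | (hm | hm)
    · exact Or.inl (Or.inl (mid_cons h q h3 hm))
    · exact Or.inl (Or.inr (mid_cons h q h2 hm))
    · exact Or.inr (Or.inl (Or.inl (mid_cons h q h3 hm)))
    · exact Or.inr (Or.inl (Or.inr (mid_cons h q h1 hm)))
    · exact Or.inr (Or.inr (Or.inl (mid_cons h q h2 hm)))
    · exact Or.inr (Or.inr (Or.inr (mid_cons h q h1 hm)))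

end Walks

section Bounds
variable {V : Type*} [DecidableEq V] {G : SimpleGraph V}

lemma raise_nonneg {ω : Sym2 V → ℝ} {b : ℝ} (hb : 0 ≤ b) (h : ∀ e ∈ G.edgeSet, 0 ≤ ω e)
    (B : Finset (Sym2 V)) : ∀ e ∈ G.edgeSet, 0 ≤ raise ω b B e := by
  intro e he
  unfold raise
  split_ifs
  · exact hb
  · exact h e he

lemma wt_raise_congr {ω : Sym2 V → ℝ} {b : ℝ} {B B' : Finset (Sym2 V)} {u w : V}
    (p : G.Walk u w) (h : ∀ e ∈ p.edges, (e ∈ B ↔ e ∈ B')) :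
    wt (raise ω b B) p = wt (raise ω b B') p := by
  apply wt_congr
  intro e he
  simp only [raise, h e he]

lemma wt_raise_mono {ω : Sym2 V → ℝ} {b : ℝ} (hωb : ∀ e ∈ G.edgeSet, ω e ≤ b)
    {B B' : Finset (Sym2 V)} {u w : V} (p : G.Walk u w) (h : B ⊆ B') :
    wt (raise ω b B) p ≤ wt (raise ω b B') p := by
  apply wt_mono
  intro e he
  have := hωb e (p.edges_subset_edgeSet he)
  by_cases h1 : e ∈ B
  · simp [raise, h1, h h1]
  · by_cases h2 : e ∈ B' <;> simp [raise, h1, h2, this]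

lemma wt_raise_insert {ω : Sym2 V → ℝ} {a b : ℝ} (hab : a ≤ b) {e0 : Sym2 V} (he0 : ω e0 = a)
    (B : Finset (Sym2 V)) {u w : V} (p : G.Walk u w) (hp : p.edges.Nodup) :
    wt (raise ω b (insert e0 B)) p ≤ wt (raise ω b B) p + (b - a) := by
  induction p with
  | nil => simp [wt_nil]; exact hab
  | cons h q ih =>
    rw [SimpleGraph.Walk.edges_cons, List.nodup_cons] at hp
    rw [wt_cons, wt_cons]
    rename_i x y z
    by_cases h1 : s(x, y) = e0
    · have h2 : wt (raise ω b (insert e0 B)) q = wt (raise ω b B) q := by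
        apply wt_raise_congr
        intro e he
        have : e ≠ e0 := by
          rintro rfl
          exact hp.1 (h1 ▸ he)
        simp [this]
      rw [h2]
      have h3 : raise ω b (insert e0 B) s(x, y) ≤ raise ω b B s(x, y) + (b - a) := by
        rw [h1]
        unfold raise
        rw [he0]
        split_ifs <;> linarith
      linarith
    · have h3 : raise ω b (insert e0 B) s(x, y) = raise ω b B s(x, y) := by
        simp [raise, h1]
      have := ih hp.2
      linarith

variable {ω : Sym2 V → ℝ} {a b : ℝ} {u w : V}

lemma gT_raise_mono (hb : 0 ≤ b) (h0 : ∀ e ∈ G.edgeSet, 0 ≤ ω e)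
    (hωb : ∀ e ∈ G.edgeSet, ω e ≤ b) (p0 : G.Walk u w) {B B' : Finset (Sym2 V)} (h : B ⊆ B') :
    gT G u w (raise ω b B) ≤ gT G u w (raise ω b B') := by
  apply le_gT p0
  intro q
  exact (gT_le (raise_nonneg hb h0 B) q).trans (wt_raise_mono hωb q h)

lemma gT_raise_insert (hb : 0 ≤ b) (h0 : ∀ e ∈ G.edgeSet, 0 ≤ ω e) (hab : a ≤ b)
    (p0 : G.Walk u w) {e0 : Sym2 V} (he0 : ω e0 = a) (B : Finset (Sym2 V)) :
    gT G u w (raise ω b (insert e0 B)) ≤ gT G u w (raise ω b B) + (b - a) := by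
  apply le_of_forall_pos_le_add
  intro ε hε
  obtain ⟨p, hp, hpt⟩ := exists_near (raise_nonneg hb h0 B) p0 hε
  have h1 := gT_le (raise_nonneg hb h0 (insert e0 B)) p
  have h2 := wt_raise_insert hab he0 B p hp.isTrail.edges_nodup
  linarith

/-- If a near-geodesic avoids `e0`, raising `e0` does not change much. -/
lemma gT_avoid (hb : 0 ≤ b) (h0 : ∀ e ∈ G.edgeSet, 0 ≤ ω e) {ε : ℝ} {e0 : Sym2 V}
    {B : Finset (Sym2 V)} {p : G.Walk u w} (hp : wt (raise ω b B) p ≤ gT G u w (raise ω b B) + ε)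
    (he : e0 ∉ p.edges) :
    gT G u w (raise ω b (insert e0 B)) ≤ gT G u w (raise ω b B) + ε := by
  refine le_trans (gT_le (raise_nonneg hb h0 _) p) (le_trans (le_of_eq ?_) hp)
  apply wt_raise_congr
  intro e hee
  have : e ≠ e0 := by
    rintro rfl
    exact he hee
  simp [this]

lemma quad_upper (hb : 0 ≤ b) (h0 : ∀ e ∈ G.edgeSet, 0 ≤ ω e)
    (hωb : ∀ e ∈ G.edgeSet, ω e ≤ b) {i j k : Sym2 V} {p q : G.Walk u w}
    (hm : Mid p i j k) (hq : j ∈ q.edges) :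
    gT G u w (raise ω b {i}) + gT G u w (raise ω b {k}) ≤
      wt (raise ω b ∅) p + wt (raise ω b {i, k}) q := by
  obtain ⟨x, hx, p1, p2, rfl, hk, hi⟩ := hm
  obtain ⟨q1, q2, rfl⟩ := exists_split q hq hx
  have e1 := gT_le (raise_nonneg hb h0 {k}) (p1.append q2)
  have e2 := gT_le (raise_nonneg hb h0 {i}) (q1.append p2)
  rw [wt_append] at e1 e2
  rw [wt_append, wt_append]
  have f1 : wt (raise ω b {k}) p1 = wt (raise ω b ∅) p1 := by
    apply wt_raise_congr
    intro e he
    have : e ≠ k := by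
      rintro rfl
      exact hk he
    simp [this]
  have f2 : wt (raise ω b {i}) p2 = wt (raise ω b ∅) p2 := by
    apply wt_raise_congr
    intro e he
    have : e ≠ i := by
      rintro rfl
      exact hi he
    simp [this]
  have f3 : wt (raise ω b {k}) q2 ≤ wt (raise ω b {i, k}) q2 := wt_raise_mono hωb _ (by simp)
  have f4 : wt (raise ω b {i}) q1 ≤ wt (raise ω b {i, k}) q1 := wt_raise_mono hωb _ (by simp)
  linarith

lemma quad_lower (hb : 0 ≤ b) (h0 : ∀ e ∈ G.edgeSet, 0 ≤ ω e)
    (hωb : ∀ e ∈ G.edgeSet, ω e ≤ b) {i j k : Sym2 V} {p q : G.Walk u w}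
    (hp : Bef p j k) (hq : Bef q i j) :
    gT G u w (raise ω b {i, k}) + gT G u w (raise ω b ∅) ≤
      wt (raise ω b {i}) p + wt (raise ω b {k}) q := by
  obtain ⟨x, hx⟩ : ∃ x, x ∈ j := by
    induction j with
    | _ a b => exact ⟨a, Sym2.mem_mk_left a b⟩
  obtain ⟨p1, p2, rfl, hk⟩ := hp.1 x hx
  obtain ⟨q1, q2, rfl, hi⟩ := hq.2 x hx
  have e1 := gT_le (raise_nonneg hb h0 {i, k}) (p1.append q2)
  have e2 := gT_le (raise_nonneg hb h0 ∅) (q1.append p2)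
  rw [wt_append] at e1 e2
  rw [wt_append, wt_append]
  have f1 : wt (raise ω b {i, k}) p1 = wt (raise ω b {i}) p1 := by
    apply wt_raise_congr
    intro e he
    have : e ≠ k := by
      rintro rfl
      exact hk he
    simp [this]
  have f2 : wt (raise ω b {i, k}) q2 = wt (raise ω b {k}) q2 := by
    apply wt_raise_congr
    intro e he
    have : e ≠ i := by
      rintro rfl
      exact hi he
    simp [this]
  have f3 : wt (raise ω b ∅) q1 ≤ wt (raise ω b {k}) q1 := wt_raise_mono hωb _ (by simp)
  have f4 : wt (raise ω b ∅) p2 ≤ wt (raise ω b {i}) p2 := wt_raise_mono hωb _ (by simp)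
  linarith

/-- Bounds on the third difference in a general graph. -/
lemma third_bounds (hb : 0 ≤ b) (h0 : ∀ e ∈ G.edgeSet, 0 ≤ ω e)
    (hωb : ∀ e ∈ G.edgeSet, ω e ≤ b) (hab : a ≤ b) (p0 : G.Walk u w)
    {i j k : Sym2 V} (hij : i ≠ j) (hik : i ≠ k) (hjk : j ≠ k)
    (hi : ω i = a) (hj : ω j = a) (hk : ω k = a) (f : Finset (Sym2 V) → ℝ)
    (hf : ∀ B, f B = gT G u w (raise ω b B)) :
    f {i, j, k} - f {i, j} - f {i, k} - f {j, k} + f {i} + f {j} + f {k} - f ∅ ≤ b - a ∧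
    -(b - a) ≤ f {i, j, k} - f {i, j} - f {i, k} - f {j, k} + f {i} + f {j} + f {k} - f ∅ := by
  have mono : ∀ {B B' : Finset (Sym2 V)}, B ⊆ B' → f B ≤ f B' := by
    intro B B' h
    rw [hf, hf]
    exact gT_raise_mono hb h0 hωb p0 h
  have ins : ∀ (e : Sym2 V) (B : Finset (Sym2 V)), ω e = a → f (insert e B) ≤ f B + (b - a) := by
    intro e B he
    rw [hf, hf]
    exact gT_raise_insert hb h0 hab p0 he B
  have near : ∀ (B : Finset (Sym2 V)) (ε : ℝ), 0 < ε →
      ∃ p : G.Walk u w, p.edges.Nodup ∧ wt (raise ω b B) p ≤ f B + ε := by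
    intro B ε hε
    obtain ⟨p, hp, hpt⟩ := exists_near (raise_nonneg hb h0 B) p0 hε
    exact ⟨p, hp.isTrail.edges_nodup, by rw [hf]; exact hpt⟩
  have avoid : ∀ {ε : ℝ} {e0 : Sym2 V} {B : Finset (Sym2 V)} {p : G.Walk u w},
      wt (raise ω b B) p ≤ f B + ε → e0 ∉ p.edges → f (insert e0 B) ≤ f B + ε := by
    intro ε e0 B p hp he
    rw [hf] at hp ⊢
    rw [hf]
    exact gT_avoid hb h0 hp he
  have c1 : ({j, i} : Finset (Sym2 V)) = {i, j} := Finset.pair_comm _ _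
  have c2 : ({k, i} : Finset (Sym2 V)) = {i, k} := Finset.pair_comm _ _
  have c3 : ({k, j} : Finset (Sym2 V)) = {j, k} := Finset.pair_comm _ _
  have d1 : insert j {i, k} = ({i, j, k} : Finset (Sym2 V)) := by
    ext x; simp only [Finset.mem_insert, Finset.mem_singleton]; tauto
  have d2 : insert k {i, j} = ({i, j, k} : Finset (Sym2 V)) := by
    ext x; simp only [Finset.mem_insert, Finset.mem_singleton]; tauto
  have m1 : f {i} ≤ f {i, j} := mono (by simp)
  have m2 : f {i} ≤ f {i, k} := mono (by simp)
  have m3 : f {j} ≤ f {i, j} := mono (by simp)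
  have m4 : f {j} ≤ f {j, k} := mono (by simp)
  have m5 : f {k} ≤ f {i, k} := mono (by simp)
  have m6 : f {k} ≤ f {j, k} := mono (by simp)
  have m7 : f ∅ ≤ f {i} := mono (by simp)
  have m8 : f ∅ ≤ f {j} := mono (by simp)
  have m9 : f ∅ ≤ f {k} := mono (by simp)
  have m10 : f {i, j} ≤ f {i, j, k} := mono (by rw [← d2]; exact Finset.subset_insert _ _)
  have m11 : f {i, k} ≤ f {i, j, k} := mono (by rw [← d1]; exact Finset.subset_insert _ _)
  have m12 : f {j, k} ≤ f {i, j, k} := mono (Finset.subset_insert _ _)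
  have l1 : f {i, j, k} ≤ f {j, k} + (b - a) := ins i _ hi
  have l2 : f {i, j, k} ≤ f {i, k} + (b - a) := by rw [← d1]; exact ins j _ hj
  have l3 : f {i, j, k} ≤ f {i, j} + (b - a) := by rw [← d2]; exact ins k _ hk
  have l4 : f {i, j} ≤ f {j} + (b - a) := ins i _ hi
  have l5 : f {i, j} ≤ f {i} + (b - a) := by rw [← c1]; exact ins j _ hj
  have l6 : f {i, k} ≤ f {k} + (b - a) := ins i _ hi
  have l7 : f {i, k} ≤ f {i} + (b - a) := by rw [← c2]; exact ins k _ hk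
  have l8 : f {j, k} ≤ f {k} + (b - a) := ins j _ hj
  have l9 : f {j, k} ≤ f {j} + (b - a) := by rw [← c3]; exact ins k _ hk
  have l10 : f {i} ≤ f ∅ + (b - a) := ins i ∅ hi
  have l11 : f {j} ≤ f ∅ + (b - a) := ins j ∅ hj
  have l12 : f {k} ≤ f ∅ + (b - a) := ins k ∅ hk
  constructor
  · apply le_of_forall_pos_le_add
    intro δ hδ
    obtain ⟨ε, hε, rfl⟩ : ∃ ε : ℝ, 0 < ε ∧ δ = 2 * ε := ⟨δ / 2, by linarith, by ring⟩
    obtain ⟨p, hp, hpt⟩ := near ∅ ε hε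
    by_cases h1 : i ∈ p.edges
    swap
    · have : f {i} ≤ f ∅ + ε := avoid hpt h1
      linarith
    by_cases h2 : j ∈ p.edges
    swap
    · have : f {j} ≤ f ∅ + ε := avoid hpt h2
      linarith
    by_cases h3 : k ∈ p.edges
    swap
    · have : f {k} ≤ f ∅ + ε := avoid hpt h3
      linarith
    obtain ⟨q1, _, hq1⟩ := near {j, k} ε hε
    obtain ⟨q2, _, hq2⟩ := near {i, k} ε hε
    obtain ⟨q3, _, hq3⟩ := near {i, j} ε hε
    by_cases g1 : i ∈ q1.edges
    swap
    · have : f {i, j, k} ≤ f {j, k} + ε := avoid hq1 g1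
      linarith
    by_cases g2 : j ∈ q2.edges
    swap
    · have := avoid hq2 g2
      rw [d1] at this
      linarith
    by_cases g3 : k ∈ q3.edges
    swap
    · have := avoid hq3 g3
      rw [d2] at this
      linarith
    have Q : ∀ {x y z : Sym2 V} {q : G.Walk u w}, Mid p x y z → y ∈ q.edges →
        f {x} + f {z} ≤ wt (raise ω b ∅) p + wt (raise ω b {x, z}) q := by
      intro x y z q hm hy
      rw [hf, hf]
      exact quad_upper hb h0 hωb hm hy
    rcases mid_total p hp h1 h2 h3 hij hik hjk with (hm | hm) | (hm | hm) | (hm | hm)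
    · have := Q hm g2
      linarith
    · have := Q hm g3
      linarith
    · have := Q hm g1
      linarith
    · have := Q hm g3
      rw [c1] at this
      linarith
    · have := Q hm g1
      rw [c3] at this
      linarith
    · have := Q hm g2
      rw [c2] at this
      linarith
  · apply le_of_forall_pos_le_add
    intro δ hδ
    obtain ⟨ε, hε, rfl⟩ : ∃ ε : ℝ, 0 < ε ∧ δ = 2 * ε := ⟨δ / 2, by linarith, by ring⟩
    obtain ⟨p1, n1, t1⟩ := near {i} ε hε
    obtain ⟨p2, n2, t2⟩ := near {j} ε hε
    obtain ⟨p3, n3, t3⟩ := near {k} ε hε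
    by_cases a1 : j ∈ p1.edges
    swap
    · have := avoid t1 a1
      rw [c1] at this
      linarith
    by_cases a2 : k ∈ p1.edges
    swap
    · have := avoid t1 a2
      rw [c2] at this
      linarith
    by_cases a3 : i ∈ p2.edges
    swap
    · have : f {i, j} ≤ f {j} + ε := avoid t2 a3
      linarith
    by_cases a4 : k ∈ p2.edges
    swap
    · have := avoid t2 a4
      rw [c3] at this
      linarith
    by_cases a5 : i ∈ p3.edges
    swap
    · have : f {i, k} ≤ f {k} + ε := avoid t3 a5
      linarith
    by_cases a6 : j ∈ p3.edges
    swap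
    · have : f {j, k} ≤ f {k} + ε := avoid t3 a6
      linarith
    have Q : ∀ {x y z : Sym2 V} {p q : G.Walk u w}, Bef p y z → Bef q x y →
        f {x, z} + f ∅ ≤ wt (raise ω b {x}) p + wt (raise ω b {z}) q := by
      intro x y z p q h1 h2
      rw [hf, hf]
      exact quad_lower hb h0 hωb h1 h2
    have fin1 : f {i, j} + f ∅ ≤ f {i} + f {j} + 2 * ε → -(b - a) ≤ f {i, j, k} - f {i, j} -
        f {i, k} - f {j, k} + f {i} + f {j} + f {k} - f ∅ + 2 * ε := by
      intro h
      linarith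
    have fin2 : f {i, k} + f ∅ ≤ f {i} + f {k} + 2 * ε → -(b - a) ≤ f {i, j, k} - f {i, j} -
        f {i, k} - f {j, k} + f {i} + f {j} + f {k} - f ∅ + 2 * ε := by
      intro h
      linarith
    have fin3 : f {j, k} + f ∅ ≤ f {j} + f {k} + 2 * ε → -(b - a) ≤ f {i, j, k} - f {i, j} -
        f {i, k} - f {j, k} + f {i} + f {j} + f {k} - f ∅ + 2 * ε := by
      intro h
      linarith
    rcases bef_total p1 n1 a1 a2 hjk with b1 | b1
    · -- `j` before `k` in `p1`
      rcases bef_total p2 n2 a3 a4 hik with b2 | b2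
      · rcases bef_total p3 n3 a5 a6 hij with b3 | b3
        · have := Q b1 b3
          exact fin2 (by linarith)
        · have := Q b2 b3
          exact fin3 (by linarith)
      · have := Q b2 b1
        rw [c1] at this
        exact fin1 (by linarith)
    · rcases bef_total p2 n2 a3 a4 hik with b2 | b2
      · have := Q b1 b2
        exact fin1 (by linarith)
      · rcases bef_total p3 n3 a5 a6 hij with b3 | b3
        · have := Q b3 b2
          rw [c3] at this
          exact fin3 (by linarith)
        · have := Q b3 b1
          rw [c2] at this
          exact fin2 (by linarith)

end Bounds

section Deriv
variable {E : Type*} [DecidableEq E]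

lemma envDeriv_comm (a b : ℝ) (i j : E) (φ : (E → ℝ) → ℝ) :
    envDeriv a b i (envDeriv a b j φ) = envDeriv a b j (envDeriv a b i φ) := by
  by_cases h : i = j
  · rw [h]
  · funext ω
    simp only [envDeriv]
    have hc : ∀ x y : ℝ, Function.update (Function.update ω i x) j y =
        Function.update (Function.update ω j y) i x :=
      fun x y => Function.update_comm h x y ω
    rw [hc, hc, hc, hc]
    ring

lemma envDerivOn_three (a b : ℝ) {i j k : E} (hij : i ≠ j) (hik : i ≠ k) (hjk : j ≠ k)
    (φ : (E → ℝ) → ℝ) (ω : E → ℝ) :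
    envDerivOn a b {i, j, k} φ ω = envDeriv a b i (envDeriv a b j (envDeriv a b k φ)) ω := by
  have hp : ({i, j, k} : Finset E).toList.Perm [i, j, k] := by
    have h1 : ([i, j, k] : List E).Nodup := by simp [hij, hik, hjk]
    have h2 : ({i, j, k} : Finset E) = [i, j, k].toFinset := by simp
    rw [h2]
    exact List.toFinset_toList h1
  unfold envDerivOn
  rw [hp.foldr_eq' (fun x _ y _ z => envDeriv_comm a b y x z)]
  rfl

lemma third_bounds_env {V : Type*} [DecidableEq V] {G : SimpleGraph V} {u w : V} {a b : ℝ}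
    (ha : 0 < a) (hab : a < b) (p0 : G.Walk u w) (S : Finset (Sym2 V)) (hS : S.card = 3)
    (ω : Sym2 V → ℝ) (hω : ∀ e ∈ G.edgeSet, ω e = a ∨ ω e = b) :
    -(b - a) ≤ envDerivOn a b S (gT G u w) ω ∧ envDerivOn a b S (gT G u w) ω ≤ b - a := by
  obtain ⟨i, j, k, hij, hik, hjk, rfl⟩ := Finset.card_eq_three.1 hS
  rw [envDerivOn_three a b hij hik hjk]
  set ω0 := Function.update (Function.update (Function.update ω i a) j a) k a with hω0
  have h0 : ∀ e ∈ G.edgeSet, ω0 e = a ∨ ω0 e = b := by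
    intro e he
    have := hω e he
    simp only [hω0, Function.update_apply]
    split_ifs <;> simp [this]
  have key := third_bounds (G := G) (u := u) (w := w) (ω := ω0) (a := a) (b := b) (by linarith)
    (by intro e he; rcases h0 e he with h | h <;> rw [h] <;> linarith)
    (by intro e he; rcases h0 e he with h | h <;> rw [h]; exact hab.le) hab.le p0 hij hik hjk
    (by simp [hω0, Function.update_apply]) (by simp [hω0, Function.update_apply])
    (by simp [hω0, Function.update_apply]) (fun B => gT G u w (raise ω0 b B)) (fun B => rfl)
  have e1 : raise ω0 b {i, j, k} =
      Function.update (Function.update (Function.update ω i b) j b) k b := by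
    funext e; simp only [raise, hω0, Function.update_apply]; grind
  have e2 : raise ω0 b {i, j} =
      Function.update (Function.update (Function.update ω i b) j b) k a := by
    funext e; simp only [raise, hω0, Function.update_apply]; grind
  have e3 : raise ω0 b {i, k} =
      Function.update (Function.update (Function.update ω i b) j a) k b := by
    funext e; simp only [raise, hω0, Function.update_apply]; grind
  have e4 : raise ω0 b {j, k} =
      Function.update (Function.update (Function.update ω i a) j b) k b := by
    funext e; simp only [raise, hω0, Function.update_apply]; grind
  have e5 : raise ω0 b {i} =
      Function.update (Function.update (Function.update ω i b) j a) k a := by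
    funext e; simp only [raise, hω0, Function.update_apply]; grind
  have e6 : raise ω0 b {j} =
      Function.update (Function.update (Function.update ω i a) j b) k a := by
    funext e; simp only [raise, hω0, Function.update_apply]; grind
  have e7 : raise ω0 b {k} =
      Function.update (Function.update (Function.update ω i a) j a) k b := by
    funext e; simp only [raise, hω0, Function.update_apply]; grind
  have e8 : raise ω0 b ∅ =
      Function.update (Function.update (Function.update ω i a) j a) k a := by
    funext e; simp only [raise, hω0, Function.update_apply]; grind
  simp only [e1, e2, e3, e4, e5, e6, e7, e8] at key
  simp only [envDeriv]
  constructor <;> linarith [key.1, key.2]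

end Deriv

/-! ### The box graph -/

/-- The graph on the box. -/
def boxG (d n : ℕ) : SimpleGraph (Vtx d) where
  Adj x y := adjV x y ∧ inBox n x ∧ inBox n y
  symm := by
    constructor
    rintro x y ⟨h, hx, hy⟩
    refine ⟨?_, hy, hx⟩
    unfold adjV at *
    rw [← h]
    exact Finset.sum_congr rfl fun i _ => abs_sub_comm _ _
  loopless := by
    constructor
    rintro x ⟨h, _, _⟩
    simp [adjV] at h

lemma boxG_edgeSet (d n : ℕ) : (boxG d n).edgeSet = EdgeSet d n := by
  ext e
  induction e with
  | _ x y =>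
    rw [SimpleGraph.mem_edgeSet]
    constructor
    · rintro ⟨h, hx, hy⟩
      exact ⟨x, y, rfl, h, hx, hy⟩
    · rintro ⟨x', y', he, h, hx, hy⟩
      have : (boxG d n).Adj x' y' := ⟨h, hx, hy⟩
      rw [← SimpleGraph.mem_edgeSet, ← he, SimpleGraph.mem_edgeSet] at this
      exact this

lemma pathTime_cons_cons {d : ℕ} (ω : Sym2 (Vtx d) → ℝ) (x y : Vtx d) (l : List (Vtx d)) :
    pathTime ω (x :: y :: l) = ω s(x, y) + pathTime ω (y :: l) := by
  simp [pathTime]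

lemma walk_of_list {d n : ℕ} (ω : Sym2 (Vtx d) → ℝ) (w : Vtx d) (l : List (Vtx d)) :
    ∀ u, IsPath n u w l → ∃ p : (boxG d n).Walk u w, wt ω p = pathTime ω l := by
  induction l with
  | nil => 
    rintro u ⟨_, h, _⟩
    simp at h
  | cons x l ih =>
    rintro u ⟨hc, h1, h2, h3⟩
    simp only [List.head?_cons, Option.some.injEq] at h1
    subst h1
    cases l with
    | nil =>
      simp only [List.getLast?_singleton, Option.some.injEq] at h2
      subst h2
      exact ⟨SimpleGraph.Walk.nil, by simp [wt_nil, pathTime]⟩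
    | cons y l =>
      have hc' := (List.isChain_cons_cons).1 hc
      have hy : IsPath n y w (y :: l) := ⟨hc'.2, rfl, by simpa using h2,
        fun z hz => h3 z (List.mem_cons_of_mem _ hz)⟩
      obtain ⟨p, hp⟩ := ih y hy
      have hadj : (boxG d n).Adj x y := ⟨hc'.1, h3 x (by simp), h3 y (by simp)⟩
      exact ⟨SimpleGraph.Walk.cons hadj p, by rw [wt_cons, pathTime_cons_cons, hp]⟩

lemma list_of_walk {d n : ℕ} (ω : Sym2 (Vtx d) → ℝ) {u w : Vtx d} (p : (boxG d n).Walk u w)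
    (hu : inBox n u) : IsPath n u w p.support ∧ wt ω p = pathTime ω p.support := by
  induction p with
  | nil =>
    refine ⟨⟨List.isChain_singleton _, rfl, rfl, by simpa using hu⟩, ?_⟩
    simp [wt_nil, pathTime]
  | @cons x y z h q ih =>
    obtain ⟨⟨h1, h2, h3, h4⟩, h5⟩ := ih h.2.2
    have hs : q.support = y :: q.support.tail := q.cons_tail_support.symm
    refine ⟨⟨?_, by simp, ?_, ?_⟩, ?_⟩
    · rw [SimpleGraph.Walk.support_cons, hs]
      refine List.isChain_cons_cons.2 ⟨h.1, ?_⟩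
      rw [← hs]
      exact h1
    · rw [SimpleGraph.Walk.support_cons, hs, List.getLast?_cons_cons, ← hs]
      exact h3
    · intro v hv
      rw [SimpleGraph.Walk.support_cons] at hv
      rcases List.mem_cons.1 hv with rfl | hv
      · exact hu
      · exact h4 v hv
    · rw [SimpleGraph.Walk.support_cons, hs, pathTime_cons_cons, ← hs, wt_cons, h5]

lemma fppT_eq (d : ℕ) (v : Vtx d) (n : ℕ) :
    fppT d v n = gT (boxG d n) 0 (fun i => (n : ℤ) * v i) := by
  funext ω
  unfold fppT gT
  congr 1
  ext t
  constructor
  · rintro ⟨l, hl, rfl⟩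
    obtain ⟨p, hp⟩ := walk_of_list ω _ l _ hl
    exact ⟨p, hp⟩
  · rintro ⟨p, rfl⟩
    obtain ⟨h1, h2⟩ := list_of_walk ω p (by intro i; simp)
    exact ⟨p.support, h1, h2⟩

lemma single_step {d : ℕ} (x : Vtx d) (k : Fin d) (s : ℤ) (hs : |s| = 1) :
    adjV x (x + Pi.single k s) := by
  unfold adjV
  rw [Finset.sum_eq_single k]
  · simp [hs]
  · intro b _ hb
    simp [hb]
  · simp

/-- Monotone lattice paths. -/
lemma mono_walk {d n : ℕ} (y : Vtx d) (hy : inBox n y) (D : ℕ) :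
    ∀ x : Vtx d, inBox n x → (∑ k, |x k - y k|) = (D : ℤ) →
      ∃ p : (boxG d n).Walk x y, p.length = D ∧
        ∀ z ∈ p.support, ∀ k, z k ∈ Set.uIcc (x k) (y k) := by
  induction D with
  | zero =>
    intro x hx h
    have hxy : x = y := by
      funext k
      have := (Finset.sum_eq_zero_iff_of_nonneg (fun k _ => abs_nonneg (x k - y k))).1
        (by simpa using h) k (Finset.mem_univ k)
      have := abs_eq_zero.1 this
      omega
    subst hxy
    refine ⟨SimpleGraph.Walk.nil, rfl, ?_⟩
    intro z hz k
    simp only [SimpleGraph.Walk.support_nil, List.mem_singleton] at hz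
    subst hz
    simp
  | succ D ih =>
    intro x hx h
    obtain ⟨k, hk⟩ : ∃ k, x k ≠ y k := by
      by_contra hcon
      push Not at hcon
      have : (∑ k, |x k - y k|) = 0 := Finset.sum_eq_zero fun k _ => by simp [hcon k]
      rw [this] at h
      push_cast at h
      omega
    obtain ⟨s, hs, hs2, hs3⟩ : ∃ s : ℤ, |s| = 1 ∧ |x k + s - y k| = |x k - y k| - 1 ∧
        ((x k < y k ∧ s = 1) ∨ (y k < x k ∧ s = -1)) := by
      rcases lt_or_gt_of_ne hk with hlt | hlt
      · refine ⟨1, by simp, ?_, Or.inl ⟨hlt, rfl⟩⟩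
        rw [abs_of_nonpos (by omega), abs_of_nonpos (by omega)]
        ring
      · refine ⟨-1, by simp, ?_, Or.inr ⟨hlt, rfl⟩⟩
        rw [abs_of_nonneg (by omega), abs_of_nonneg (by omega)]
        ring
    set x' := x + Pi.single k s with hx'
    have hkk : x' k = x k + s := by simp [hx']
    have hkn : ∀ m, m ≠ k → x' m = x m := by
      intro m hm
      simp [hx', hm]
    have hbox : inBox n x' := by
      intro m
      by_cases hm : m = k
      · subst hm
        have h1 := hx m
        have h2 := hy m
        rw [hkk]
        rw [abs_le] at h1 h2 ⊢
        omega
      · rw [hkn m hm]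
        exact hx m
    have hsum : (∑ m, |x' m - y m|) = (D : ℤ) := by
      have h1 := Finset.add_sum_erase Finset.univ (fun m => |x m - y m|) (Finset.mem_univ k)
      have h2 := Finset.add_sum_erase Finset.univ (fun m => |x' m - y m|) (Finset.mem_univ k)
      have h3 : ∑ m ∈ Finset.univ.erase k, |x' m - y m| = ∑ m ∈ Finset.univ.erase k, |x m - y m| :=
        Finset.sum_congr rfl fun m hm => by rw [hkn m (Finset.ne_of_mem_erase hm)]
      rw [hkk] at h2
      push_cast at h
      omega
    obtain ⟨p, hp, hps⟩ := ih x' hbox hsum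
    have hadj : (boxG d n).Adj x x' := ⟨single_step x k s hs, hx, hbox⟩
    refine ⟨SimpleGraph.Walk.cons hadj p, by simp [hp], ?_⟩
    intro z hz m
    rw [SimpleGraph.Walk.support_cons] at hz
    rcases List.mem_cons.1 hz with rfl | hz
    · exact Set.left_mem_uIcc
    · have := hps z hz m
      by_cases hm : m = k
      · subst hm
        rw [hkk] at this
        rw [Set.mem_uIcc] at this ⊢
        omega
      · rw [hkn m hm] at this
        exact this

lemma length_ge {d n : ℕ} {x y : Vtx d} (p : (boxG d n).Walk x y) :
    (∑ k, |x k - y k|) ≤ (p.length : ℤ) := by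
  induction p with
  | nil => simp
  | @cons x y z h q ih =>
    have h1 : (∑ k, |x k - y k|) = 1 := h.1
    have h2 : (∑ k, |x k - z k|) ≤ (∑ k, |x k - y k|) + ∑ k, |y k - z k| := by
      rw [← Finset.sum_add_distrib]
      exact Finset.sum_le_sum fun k _ => abs_sub_le _ _ _
    rw [SimpleGraph.Walk.length_cons]
    push_cast
    linarith

lemma wt_ge_potential {V : Type*} {G : SimpleGraph V} {ω : Sym2 V → ℝ} (ψ : V → ℝ) {u w : V}
    (p : G.Walk u w) (h : ∀ x y, s(x, y) ∈ p.edges → ψ y - ψ x ≤ ω s(x, y)) :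
    ψ w - ψ u ≤ wt ω p := by
  induction p with
  | nil => simp [wt_nil]
  | @cons x y z hh q ih =>
    rw [wt_cons]
    have h1 := h x y (by simp)
    have h2 := ih (fun x y hxy => h x y (by simp [hxy]))
    linarith

section Gadget
variable {V : Type*} {G : SimpleGraph V}

lemma wt_ge_len {ω : Sym2 V → ℝ} {a : ℝ} {u w : V} (p : G.Walk u w)
    (h : ∀ e ∈ p.edges, a ≤ ω e) : p.length * a ≤ wt ω p := by
  induction p with
  | nil => simp [wt_nil]
  | @cons x y z hh q ih =>
    rw [wt_cons, SimpleGraph.Walk.length_cons]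
    have h1 := h s(x, y) (by simp)
    have h2 := ih (fun e he => h e (by simp [he]))
    push_cast
    linarith

lemma wt_eq_len {ω : Sym2 V → ℝ} {a : ℝ} {u w : V} (p : G.Walk u w)
    (h : ∀ e ∈ p.edges, ω e = a) : wt ω p = p.length * a := by
  induction p with
  | nil => simp [wt_nil]
  | @cons x y z hh q ih =>
    rw [wt_cons, SimpleGraph.Walk.length_cons]
    have h1 := h s(x, y) (by simp)
    have h2 := ih (fun e he => h e (by simp [he]))
    push_cast
    linarith

lemma wt_ge_len_b {ω : Sym2 V → ℝ} {a b : ℝ} {u w : V} (p : G.Walk u w)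
    (h : ∀ e ∈ p.edges, a ≤ ω e) (hb : ∃ e ∈ p.edges, ω e = b) :
    p.length * a + (b - a) ≤ wt ω p := by
  induction p with
  | nil => simp at hb
  | @cons x y z hh q ih =>
    rw [wt_cons, SimpleGraph.Walk.length_cons]
    have h1 := h s(x, y) (by simp)
    have h3 : ∀ e ∈ q.edges, a ≤ ω e := fun e he => h e (by simp [he])
    obtain ⟨e, he, hbe⟩ := hb
    rw [SimpleGraph.Walk.edges_cons] at he
    push_cast
    rcases List.mem_cons.1 he with rfl | he
    · have := wt_ge_len q h3
      linarith
    · have := ih h3 ⟨e, he, hbe⟩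
      linarith

/-- Environment with prescribed values on four edges, `a` on `H` and `b` elsewhere. -/
def genv {E : Type*} [DecidableEq E] (H : Set E) [DecidablePred (· ∈ H)] (a b : ℝ)
    (e0 e1 e2 e3 : E) (x0 x1 x2 x3 : ℝ) : E → ℝ :=
  fun e => if e = e0 then x0 else if e = e1 then x1 else if e = e2 then x2 else
    if e = e3 then x3 else if e ∈ H then a else b

variable [DecidableEq V]

lemma gadget_val {a b : ℝ} (ha : 0 < a) (hab : a < b) {o z a1 a2 a3 b1 : V}
    (hnd : [o, a1, a2, a3, b1].Nodup) (hz : z ≠ o ∧ z ≠ a1 ∧ z ≠ a2)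
    (h1 : G.Adj o a1) (h2 : G.Adj a1 a2) (h3 : G.Adj a2 a3) (h0 : G.Adj o b1)
    (H : Set (Sym2 V)) [DecidablePred (· ∈ H)] (hH : ∀ e ∈ H, o ∉ e ∧ a1 ∉ e ∧ a2 ∉ e)
    {m : ℕ} (τ : G.Walk a3 z) (hτ : τ.length = m) (hτH : ∀ e ∈ τ.edges, e ∈ H)
    (β : G.Walk b1 z) (hβ : β.length = m + 2) (hβH : ∀ e ∈ β.edges, e ∈ H)
    (hlen : ∀ p : G.Walk o z, m + 3 ≤ p.length ∨ ∀ ω : Sym2 V → ℝ,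
      (∀ e ∈ p.edges, a ≤ ω e) → (∀ e ∈ p.edges, e ∉ H → e ≠ s(o, b1) → e ≠ s(o, a1) →
        e ≠ s(a1, a2) → e ≠ s(a2, a3) → ω e = b) → (m + 2) * a + b ≤ wt ω p)
    {x0 x1 x2 x3 : ℝ} (v0 : x0 = a ∨ x0 = b) (v1 : x1 = a ∨ x1 = b) (v2 : x2 = a ∨ x2 = b)
    (v3 : x3 = a ∨ x3 = b) :
    ((x0 = b ∧ (x1 = b ∨ x2 = b ∨ x3 = b)) →
      gT G o z (genv H a b s(o, b1) s(o, a1) s(a1, a2) s(a2, a3) x0 x1 x2 x3) =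
        (m + 2) * a + b) ∧
    ((x0 = a ∨ (x1 = a ∧ x2 = a ∧ x3 = a)) →
      gT G o z (genv H a b s(o, b1) s(o, a1) s(a1, a2) s(a2, a3) x0 x1 x2 x3) =
        (m + 3) * a) := by
  simp only [List.nodup_cons, List.mem_cons, not_or, List.not_mem_nil, not_false_eq_true,
    and_true, List.nodup_nil] at hnd
  obtain ⟨⟨n1, n2, n3, n4⟩, ⟨n5, n6, n7⟩, ⟨n8, n9⟩, n10⟩ := hnd
  set ω := genv H a b s(o, b1) s(o, a1) s(a1, a2) s(a2, a3) x0 x1 x2 x3 with hω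
  have va : ∀ e, ω e = a ∨ ω e = b := by
    intro e
    simp only [hω, genv]
    split_ifs <;> simp [*]
  have ge : ∀ e, a ≤ ω e := by
    intro e
    rcases va e with h | h <;> rw [h]
    exact hab.le
  have nn : ∀ e ∈ G.edgeSet, 0 ≤ ω e := fun e _ => ha.le.trans (ge e)
  have w0 : ω s(o, b1) = x0 := by simp [hω, genv]
  have w1 : ω s(o, a1) = x1 := by
    have : s(o, a1) ≠ s(o, b1) := by rw [Ne, Sym2.eq_iff]; grind
    simp only [hω, genv, if_neg this, if_true]
  have w2 : ω s(a1, a2) = x2 := by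
    have t1 : s(a1, a2) ≠ s(o, b1) := by rw [Ne, Sym2.eq_iff]; grind
    have t2 : s(a1, a2) ≠ s(o, a1) := by rw [Ne, Sym2.eq_iff]; grind
    simp only [hω, genv, if_neg t1, if_neg t2, if_true]
  have w3 : ω s(a2, a3) = x3 := by
    have t1 : s(a2, a3) ≠ s(o, b1) := by rw [Ne, Sym2.eq_iff]; grind
    have t2 : s(a2, a3) ≠ s(o, a1) := by rw [Ne, Sym2.eq_iff]; grind
    have t3 : s(a2, a3) ≠ s(a1, a2) := by rw [Ne, Sym2.eq_iff]; grind
    simp only [hω, genv, if_neg t1, if_neg t2, if_neg t3, if_true]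
  have wH : ∀ e ∈ H, ω e = a := by
    intro e he
    obtain ⟨g1, g2, g3⟩ := hH e he
    have t1 : e ≠ s(o, b1) := by rintro rfl; simp at g1
    have t2 : e ≠ s(o, a1) := by rintro rfl; simp at g1
    have t3 : e ≠ s(a1, a2) := by rintro rfl; simp at g2
    have t4 : e ≠ s(a2, a3) := by rintro rfl; simp at g3
    simp only [hω, genv, if_neg t1, if_neg t2, if_neg t3, if_neg t4, if_pos he]
  have wb : ∀ e, e ∉ H → e ≠ s(o, b1) → e ≠ s(o, a1) → e ≠ s(a1, a2) → e ≠ s(a2, a3) →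
      ω e = b := by
    intro e t0 t1 t2 t3 t4
    simp only [hω, genv, if_neg t1, if_neg t2, if_neg t3, if_neg t4, if_neg t0]
  have hB := gT_le nn (SimpleGraph.Walk.cons h0 β)
  rw [wt_cons, w0, wt_eq_len β (fun e he => wH e (hβH e he)), hβ] at hB
  have hA := gT_le nn (SimpleGraph.Walk.cons h1 (SimpleGraph.Walk.cons h2
    (SimpleGraph.Walk.cons h3 τ)))
  rw [wt_cons, wt_cons, wt_cons, w1, w2, w3, wt_eq_len τ (fun e he => wH e (hτH e he)), hτ] at hA
  push_cast at hA hB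
  constructor
  · rintro ⟨rfl, hx⟩
    apply le_antisymm
    · linarith
    · apply le_gT (SimpleGraph.Walk.cons h0 β)
      intro p
      have hcut : ∃ e ∈ p.edges, ω e = x0 := by
        have cut : ∀ C : Set V, o ∈ C → z ∉ C → (∀ x ∈ C, x = o ∨ x = a1 ∨ x = a2) →
            (∀ x y, x ∈ C → y ∉ C → s(x, y) = s(o, a1) → x1 = x0) →
            (∀ x y, x ∈ C → y ∉ C → s(x, y) = s(a1, a2) → x2 = x0) →
            (∀ x y, x ∈ C → y ∉ C → s(x, y) = s(a2, a3) → x3 = x0) →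
            ∃ e ∈ p.edges, ω e = x0 := by
          intro C hoC hzC hC c1 c2 c3
          obtain ⟨dd, hd, hd1, hd2⟩ := p.exists_boundary_dart C hoC hzC
          refine ⟨dd.edge, List.mem_map_of_mem hd, ?_⟩
          have hde : dd.edge = s(dd.fst, dd.snd) := rfl
          rw [hde]
          by_cases k0 : s(dd.fst, dd.snd) = s(o, b1)
          · rw [k0, w0]
          by_cases k1 : s(dd.fst, dd.snd) = s(o, a1)
          · rw [k1, w1]
            exact c1 _ _ hd1 hd2 k1
          by_cases k2 : s(dd.fst, dd.snd) = s(a1, a2)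
          · rw [k2, w2]
            exact c2 _ _ hd1 hd2 k2
          by_cases k3 : s(dd.fst, dd.snd) = s(a2, a3)
          · rw [k3, w3]
            exact c3 _ _ hd1 hd2 k3
          refine wb _ (fun hh => ?_) k0 k1 k2 k3
          obtain ⟨g1, g2, g3⟩ := hH _ hh
          rcases hC _ hd1 with h | h | h <;> rw [h] at g1 g2 g3 <;> simp at g1 g2 g3
        rcases hx with hx | hx | hx
        · refine cut {o} rfl hz.1 (by simp) (fun _ _ _ _ _ => hx) ?_ ?_ <;>
          · intro x y hx' hy' he
            simp only [Set.mem_singleton_iff] at hx' hy'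
            rw [Sym2.eq_iff] at he
            grind
        · refine cut {o, a1} (by simp) (by simp [hz.1, hz.2.1]) (by simp +contextual) ?_
            (fun _ _ _ _ _ => hx) ?_ <;>
          · intro x y hx' hy' he
            simp only [Set.mem_singleton_iff, Set.mem_insert_iff] at hx' hy'
            rw [Sym2.eq_iff] at he
            grind
        · refine cut {o, a1, a2} (by simp) (by simp [hz.1, hz.2.1, hz.2.2]) (by simp) ?_ ?_
            (fun _ _ _ _ _ => hx) <;>
          · intro x y hx' hy' he
            simp only [Set.mem_singleton_iff, Set.mem_insert_iff] at hx' hy'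
            rw [Sym2.eq_iff] at he
            grind
      rcases hlen p with hl | hl
      · have := wt_ge_len_b p (fun e _ => ge e) hcut
        have hl' : ((m : ℝ) + 3) * a ≤ p.length * a := by
          apply mul_le_mul_of_nonneg_right _ ha.le
          exact_mod_cast hl
        linarith
      · exact hl ω (fun e _ => ge e) (fun e _ => wb e)
  · intro hx
    apply le_antisymm
    · rcases hx with rfl | ⟨rfl, rfl, rfl⟩
      · linarith
      · linarith
    · apply le_gT (SimpleGraph.Walk.cons h0 β)
      intro p
      rcases hlen p with hl | hl
      · have := wt_ge_len p (fun e _ => ge e)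
        have hl' : ((m : ℝ) + 3) * a ≤ p.length * a := by
          apply mul_le_mul_of_nonneg_right _ ha.le
          exact_mod_cast hl
        linarith
      · have := hl ω (fun e _ => ge e) (fun e _ => wb e)
        linarith

lemma gadget {a b : ℝ} (ha : 0 < a) (hab : a < b) {o z a1 a2 a3 b1 : V}
    (hnd : [o, a1, a2, a3, b1].Nodup) (hz : z ≠ o ∧ z ≠ a1 ∧ z ≠ a2)
    (h1 : G.Adj o a1) (h2 : G.Adj a1 a2) (h3 : G.Adj a2 a3) (h0 : G.Adj o b1)
    (H : Set (Sym2 V)) (hH : ∀ e ∈ H, o ∉ e ∧ a1 ∉ e ∧ a2 ∉ e)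
    {m : ℕ} (τ : G.Walk a3 z) (hτ : τ.length = m) (hτH : ∀ e ∈ τ.edges, e ∈ H)
    (β : G.Walk b1 z) (hβ : β.length = m + 2) (hβH : ∀ e ∈ β.edges, e ∈ H)
    (hlen : ∀ p : G.Walk o z, m + 3 ≤ p.length ∨ ∀ ω : Sym2 V → ℝ,
      (∀ e ∈ p.edges, a ≤ ω e) → (∀ e ∈ p.edges, e ∉ H → e ≠ s(o, b1) → e ≠ s(o, a1) →
        e ≠ s(a1, a2) → e ≠ s(a2, a3) → ω e = b) → (m + 2) * a + b ≤ wt ω p) :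
    (∃ (S : Finset (Sym2 V)) (ω : Sym2 V → ℝ), ↑S ⊆ G.edgeSet ∧ S.card = 3 ∧
      (∀ e, ω e = a ∨ ω e = b) ∧ envDerivOn a b S (gT G o z) ω = b - a) ∧
    (∃ (S : Finset (Sym2 V)) (ω : Sym2 V → ℝ), ↑S ⊆ G.edgeSet ∧ S.card = 3 ∧
      (∀ e, ω e = a ∨ ω e = b) ∧ envDerivOn a b S (gT G o z) ω = -(b - a)) := by
  classical
  have val := fun {x0 x1 x2 x3 : ℝ} (v0 : x0 = a ∨ x0 = b) (v1 : x1 = a ∨ x1 = b)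
    (v2 : x2 = a ∨ x2 = b) (v3 : x3 = a ∨ x3 = b) => gadget_val ha hab hnd hz h1 h2 h3 h0 H hH
    τ hτ hτH β hβ hβH hlen v0 v1 v2 v3
  simp only [List.nodup_cons, List.mem_cons, not_or, List.not_mem_nil, not_false_eq_true,
    and_true, List.nodup_nil] at hnd
  obtain ⟨⟨n1, n2, n3, n4⟩, ⟨n5, n6, n7⟩, ⟨n8, n9⟩, n10⟩ := hnd
  have t01 : s(o, b1) ≠ s(o, a1) := by rw [Ne, Sym2.eq_iff]; grind
  have t02 : s(o, b1) ≠ s(a1, a2) := by rw [Ne, Sym2.eq_iff]; grind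
  have t03 : s(o, b1) ≠ s(a2, a3) := by rw [Ne, Sym2.eq_iff]; grind
  have t12 : s(o, a1) ≠ s(a1, a2) := by rw [Ne, Sym2.eq_iff]; grind
  have t13 : s(o, a1) ≠ s(a2, a3) := by rw [Ne, Sym2.eq_iff]; grind
  have t23 : s(a1, a2) ≠ s(a2, a3) := by rw [Ne, Sym2.eq_iff]; grind
  have g0 : s(o, b1) ∈ G.edgeSet := h0
  have g1 : s(o, a1) ∈ G.edgeSet := h1
  have g2 : s(a1, a2) ∈ G.edgeSet := h2
  have g3 : s(a2, a3) ∈ G.edgeSet := h3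
  generalize s(o, b1) = e0 at *
  generalize s(o, a1) = e1 at *
  generalize s(a1, a2) = e2 at *
  generalize s(a2, a3) = e3 at *
  have va : ∀ {x0 x1 x2 x3 : ℝ}, (x0 = a ∨ x0 = b) → (x1 = a ∨ x1 = b) →
      (x2 = a ∨ x2 = b) → (x3 = a ∨ x3 = b) →
      ∀ e, genv H a b e0 e1 e2 e3 x0 x1 x2 x3 e = a ∨
        genv H a b e0 e1 e2 e3 x0 x1 x2 x3 e = b := by
    intro x0 x1 x2 x3 v0 v1 v2 v3 e
    simp only [genv]
    split_ifs <;> simp [*]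
  have u0 : ∀ x0 x1 x2 x3 y, Function.update (genv H a b e0 e1 e2 e3 x0 x1 x2 x3) e0 y =
      genv H a b e0 e1 e2 e3 y x1 x2 x3 := by
    intro x0 x1 x2 x3 y
    funext e
    simp only [genv, Function.update_apply]
    grind
  have u1 : ∀ x0 x1 x2 x3 y, Function.update (genv H a b e0 e1 e2 e3 x0 x1 x2 x3) e1 y =
      genv H a b e0 e1 e2 e3 x0 y x2 x3 := by
    intro x0 x1 x2 x3 y
    funext e
    simp only [genv, Function.update_apply]
    grind
  have u2 : ∀ x0 x1 x2 x3 y, Function.update (genv H a b e0 e1 e2 e3 x0 x1 x2 x3) e2 y =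
      genv H a b e0 e1 e2 e3 x0 x1 y x3 := by
    intro x0 x1 x2 x3 y
    funext e
    simp only [genv, Function.update_apply]
    grind
  have u3 : ∀ x0 x1 x2 x3 y, Function.update (genv H a b e0 e1 e2 e3 x0 x1 x2 x3) e3 y =
      genv H a b e0 e1 e2 e3 x0 x1 x2 y := by
    intro x0 x1 x2 x3 y
    funext e
    simp only [genv, Function.update_apply]
    grind
  have la : a = a ∨ a = b := Or.inl rfl
  have lb : b = a ∨ b = b := Or.inr rfl
  constructor
  · refine ⟨{e1, e2, e3}, genv H a b e0 e1 e2 e3 b a a a, ?_, ?_, va lb la la la, ?_⟩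
    · intro e he
      simp only [Finset.coe_insert, Finset.coe_singleton, Set.mem_insert_iff,
        Set.mem_singleton_iff] at he
      rcases he with rfl | rfl | rfl <;> assumption
    · exact Finset.card_eq_three.2 ⟨_, _, _, t12, t13, t23, rfl⟩
    · rw [envDerivOn_three a b t12 t13 t23]
      simp only [envDeriv, u1, u2, u3]
      rw [(val lb lb lb lb).1 (by simp), (val lb lb lb la).1 (by simp),
        (val lb lb la lb).1 (by simp), (val lb lb la la).1 (by simp),
        (val lb la lb lb).1 (by simp), (val lb la lb la).1 (by simp),
        (val lb la la lb).1 (by simp), (val lb la la la).2 (by simp)]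
      ring
  · refine ⟨{e0, e1, e2}, genv H a b e0 e1 e2 e3 a a a a, ?_, ?_, va la la la la, ?_⟩
    · intro e he
      simp only [Finset.coe_insert, Finset.coe_singleton, Set.mem_insert_iff,
        Set.mem_singleton_iff] at he
      rcases he with rfl | rfl | rfl <;> assumption
    · exact Finset.card_eq_three.2 ⟨_, _, _, t01, t02, t12, rfl⟩
    · rw [envDerivOn_three a b t01 t02 t12]
      simp only [envDeriv, u0, u1, u2]
      rw [(val lb lb lb la).1 (by simp), (val lb lb la la).1 (by simp),
        (val lb la lb la).1 (by simp), (val lb la la la).2 (by simp),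
        (val la lb lb la).2 (by simp), (val la lb la la).2 (by simp),
        (val la la lb la).2 (by simp), (val la la la la).2 (by simp)]
      ring

end Gadget

/-- The cheap edges of the gadget in the lattice. -/
def cheap {d : ℕ} (i j : Fin d) (s : ℤ) : Set (Sym2 (Vtx d)) :=
  {e | (∀ x ∈ e, x ≠ 0 ∧ x ≠ Pi.single i s ∧ x ≠ Pi.single i (2 * s)) ∧ ∃ x ∈ e, x j ≠ 0}

lemma cheap_of_ne {d : ℕ} {i j : Fin d} (hij : i ≠ j) {s : ℤ} {x y : Vtx d} (hx : x j ≠ 0)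
    (hy : y j ≠ 0) : s(x, y) ∈ cheap i j s := by
  have key : ∀ z : Vtx d, z j ≠ 0 → z ≠ 0 ∧ z ≠ Pi.single i s ∧ z ≠ Pi.single i (2 * s) := by
    intro z hz
    refine ⟨?_, ?_, ?_⟩ <;>
    · rintro rfl
      simp [hij.symm] at hz
  refine ⟨?_, x, Sym2.mem_mk_left _ _, hx⟩
  intro z hz
  rcases Sym2.mem_iff.1 hz with rfl | rfl
  · exact key _ hx
  · exact key _ hy

lemma concrete_gadget {d n : ℕ} {i j : Fin d} (hij : i ≠ j) {s t : ℤ} (hs : |s| = 1)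
    (ht : |t| = 1) (hn : 1 ≤ n) {a b : ℝ} (ha : 0 < a) (hab : a < b) (z : Vtx d)
    (hz : z ≠ 0 ∧ z ≠ Pi.single i s ∧ z ≠ Pi.single i (2 * s)) {m : ℕ}
    (τ : (boxG d n).Walk (Pi.single i (2 * s) + Pi.single j t) z) (hτ : τ.length = m)
    (hτH : ∀ e ∈ τ.edges, e ∈ cheap i j s)
    (hlen : ∀ p : (boxG d n).Walk 0 z, m + 3 ≤ p.length ∨ ∀ ω : Sym2 (Vtx d) → ℝ,
      (∀ e ∈ p.edges, a ≤ ω e) → (∀ e ∈ p.edges, e ∉ cheap i j s →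
        e ≠ s(0, Pi.single j t) → e ≠ s(0, Pi.single i s) →
        e ≠ s(Pi.single i s, Pi.single i (2 * s)) →
        e ≠ s(Pi.single i (2 * s), Pi.single i (2 * s) + Pi.single j t) → ω e = b) →
        (m + 2) * a + b ≤ wt ω p) :
    (∃ (S : Finset (Sym2 (Vtx d))) (ω : Sym2 (Vtx d) → ℝ), ↑S ⊆ EdgeSet d n ∧ S.card = 3 ∧
      ValidEnv d n a b ω ∧ envDerivOn a b S (gT (boxG d n) 0 z) ω = b - a) ∧
    (∃ (S : Finset (Sym2 (Vtx d))) (ω : Sym2 (Vtx d) → ℝ), ↑S ⊆ EdgeSet d n ∧ S.card = 3 ∧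
      ValidEnv d n a b ω ∧ envDerivOn a b S (gT (boxG d n) 0 z) ω = -(b - a)) := by
  have hs' : s = 1 ∨ s = -1 := eq_or_eq_neg_of_abs_eq hs
  have ht' : t = 1 ∨ t = -1 := eq_or_eq_neg_of_abs_eq ht
  have box : ∀ x y : ℤ, |x| ≤ 2 → |y| ≤ 1 → inBox n (Pi.single i x + Pi.single j y : Vtx d) := by
    intro x y hx hy k
    rw [abs_le] at hx hy ⊢
    simp only [Pi.add_apply, Pi.single_apply]
    split_ifs with h1 h2
    · exact absurd (h1.symm.trans h2) hij
    all_goals omega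
  have b0 : inBox n (0 : Vtx d) := by simpa using box 0 0 (by simp) (by simp)
  have b1 : inBox n (Pi.single i s : Vtx d) := by
    simpa using box s 0 (by omega) (by simp)
  have b2 : inBox n (Pi.single i (2 * s) : Vtx d) := by
    simpa using box (2 * s) 0 (by rw [abs_mul, hs]; norm_num) (by simp)
  have b3 : inBox n (Pi.single i (2 * s) + Pi.single j t : Vtx d) :=
    box (2 * s) t (by rw [abs_mul, hs]; norm_num) (by omega)
  have b4 : inBox n (Pi.single j t : Vtx d) := by
    simpa using box 0 t (by simp) (by omega)
  have b5 : inBox n (Pi.single i s + Pi.single j t : Vtx d) := box s t (by omega) (by omega)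
  have h1 : (boxG d n).Adj 0 (Pi.single i s) :=
    ⟨by simpa using single_step (0 : Vtx d) i s hs, b0, b1⟩
  have h0 : (boxG d n).Adj 0 (Pi.single j t) :=
    ⟨by simpa using single_step (0 : Vtx d) j t ht, b0, b4⟩
  have h2 : (boxG d n).Adj (Pi.single i s) (Pi.single i (2 * s)) := by
    refine ⟨?_, b1, b2⟩
    have := single_step (Pi.single i s : Vtx d) i s hs
    rwa [← Pi.single_add, ← two_mul] at this
  have h3 : (boxG d n).Adj (Pi.single i (2 * s)) (Pi.single i (2 * s) + Pi.single j t) :=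
    ⟨single_step _ j t ht, b2, b3⟩
  have h4 : (boxG d n).Adj (Pi.single j t) (Pi.single i s + Pi.single j t) := by
    refine ⟨?_, b4, b5⟩
    rw [add_comm]
    exact single_step _ i s hs
  have h5 : (boxG d n).Adj (Pi.single i s + Pi.single j t)
      (Pi.single i (2 * s) + Pi.single j t) := by
    refine ⟨?_, b5, b3⟩
    have := single_step (Pi.single i s + Pi.single j t : Vtx d) i s hs
    rwa [add_right_comm, ← Pi.single_add, ← two_mul] at this
  have hnd : [(0 : Vtx d), Pi.single i s, Pi.single i (2 * s),
      Pi.single i (2 * s) + Pi.single j t, Pi.single j t].Nodup := by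
    have hd : ∀ {x y : Vtx d}, (x i ≠ y i ∨ x j ≠ y j) → x ≠ y := by
      rintro x y h rfl
      simp at h
    have hji := hij.symm
    simp only [List.nodup_cons, List.mem_cons, not_or, List.not_mem_nil, not_false_eq_true,
      and_true, List.nodup_nil]
    refine ⟨⟨?_, ?_, ?_, ?_⟩, ⟨?_, ?_, ?_⟩, ⟨?_, ?_⟩, ?_⟩ <;> apply hd <;>
      simp [hij, hji] <;> omega
  have tj : t ≠ 0 := by omega
  have key := gadget (G := boxG d n) ha hab hnd hz h1 h2 h3 h0 (cheap i j s) (m := m)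
    (by
      intro e he
      refine ⟨fun h => (he.1 _ h).1 rfl, fun h => (he.1 _ h).2.1 rfl,
        fun h => (he.1 _ h).2.2 rfl⟩)
    τ hτ hτH (SimpleGraph.Walk.cons h4 (SimpleGraph.Walk.cons h5 τ)) (by simp [hτ])
    (by
      intro e he
      rw [SimpleGraph.Walk.edges_cons, SimpleGraph.Walk.edges_cons] at he
      rcases List.mem_cons.1 he with rfl | he
      · apply cheap_of_ne hij <;> simp [hij.symm, tj]
      rcases List.mem_cons.1 he with rfl | he
      · apply cheap_of_ne hij <;> simp [hij.symm, tj]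
      exact hτH e he) hlen
  rw [boxG_edgeSet] at key
  obtain ⟨⟨S, ω, k1, k2, k3, k4⟩, ⟨S', ω', k1', k2', k3', k4'⟩⟩ := key
  exact ⟨⟨S, ω, k1, k2, fun e _ => k3 e, k4⟩, ⟨S', ω', k1', k2', fun e _ => k3' e, k4'⟩⟩

lemma edge_support {V : Type*} {G : SimpleGraph V} {u w : V} (p : G.Walk u w) {e : Sym2 V}
    (he : e ∈ p.edges) : ∃ x y, e = s(x, y) ∧ x ∈ p.support ∧ y ∈ p.support := by
  induction e with
  | _ x y =>
    exact ⟨x, y, rfl, p.fst_mem_support_of_mem_edges he, p.snd_mem_support_of_mem_edges he⟩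

lemma exists_sign_s17 (x : ℤ) (hx : x ≠ 0) : ∃ s : ℤ, |s| = 1 ∧ 0 < s * x := by
  rcases lt_or_gt_of_ne hx with h | h
  · exact ⟨-1, by simp, by omega⟩
  · exact ⟨1, by simp, by omega⟩

lemma sum_abs_corner {d : ℕ} {i j : Fin d} (z : Vtx d) (hij : i ≠ j) {s t : ℤ}
    (hs : |s| = 1) (ht : |t| = 1) (h1 : 2 ≤ s * z i) (h2 : 1 ≤ t * z j) :
    (∑ k, |(Pi.single i (2 * s) + Pi.single j t : Vtx d) k - z k|) + 3 = ∑ k, |z k| := by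
  have hs' : s = 1 ∨ s = -1 := eq_or_eq_neg_of_abs_eq hs
  have ht' : t = 1 ∨ t = -1 := eq_or_eq_neg_of_abs_eq ht
  have key : ∀ k, |z k| = |(Pi.single i (2 * s) + Pi.single j t : Vtx d) k - z k| +
      ((if k = i then 2 else 0) + (if k = j then 1 else 0)) := by
    intro k
    simp only [Pi.add_apply, Pi.single_apply]
    split_ifs with g1 g2 g2
    · exact absurd (g1.symm.trans g2) hij
    · subst g1
      rcases hs' with rfl | rfl
      · rw [abs_of_nonneg (by omega), abs_of_nonpos (by omega)]; ring
      · rw [abs_of_nonpos (by omega), abs_of_nonneg (by omega)]; ring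
    · subst g2
      rcases ht' with rfl | rfl
      · rw [abs_of_nonneg (by omega), abs_of_nonpos (by omega)]; ring
      · rw [abs_of_nonpos (by omega), abs_of_nonneg (by omega)]; ring
    · simp
  rw [Finset.sum_congr rfl fun k _ => key k, Finset.sum_add_distrib, Finset.sum_add_distrib]
  simp

/-- The case of two nonzero coordinates. -/
lemma case_two {d n : ℕ} {i j : Fin d} (hij : i ≠ j) {a b : ℝ} (ha : 0 < a) (hab : a < b)
    (z : Vtx d) (hbz : inBox n z) (hn : 1 ≤ n) {s t : ℤ} (hs : |s| = 1) (ht : |t| = 1)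
    (hi : 2 ≤ s * z i) (hj : 1 ≤ t * z j) :
    (∃ (S : Finset (Sym2 (Vtx d))) (ω : Sym2 (Vtx d) → ℝ), ↑S ⊆ EdgeSet d n ∧ S.card = 3 ∧
      ValidEnv d n a b ω ∧ envDerivOn a b S (gT (boxG d n) 0 z) ω = b - a) ∧
    (∃ (S : Finset (Sym2 (Vtx d))) (ω : Sym2 (Vtx d) → ℝ), ↑S ⊆ EdgeSet d n ∧ S.card = 3 ∧
      ValidEnv d n a b ω ∧ envDerivOn a b S (gT (boxG d n) 0 z) ω = -(b - a)) := by
  have ht' : t = 1 ∨ t = -1 := eq_or_eq_neg_of_abs_eq ht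
  have hs' : s = 1 ∨ s = -1 := eq_or_eq_neg_of_abs_eq hs
  have hzj : z j ≠ 0 := by
    intro h
    simp [h] at hj
  obtain ⟨m, hm⟩ := Int.eq_ofNat_of_zero_le (a := ∑ k, |(Pi.single i (2 * s) + Pi.single j t :
    Vtx d) k - z k|) (Finset.sum_nonneg fun k _ => abs_nonneg _)
  have hsum := sum_abs_corner z hij hs ht hi hj
  have hb3 : inBox n (Pi.single i (2 * s) + Pi.single j t : Vtx d) := by
    intro k
    simp only [Pi.add_apply, Pi.single_apply]
    rw [abs_le]
    split_ifs with h1 h2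
    · exact absurd (h1.symm.trans h2) hij
    all_goals omega
  obtain ⟨τ, hτ, hτs⟩ := mono_walk z hbz m _ hb3 hm
  refine concrete_gadget hij hs ht hn ha hab z ?_ τ hτ ?_ ?_
  · refine ⟨?_, ?_, ?_⟩ <;>
    · rintro rfl
      simp [hij.symm] at hzj
  · intro e he
    obtain ⟨x, y, rfl, hx, hy⟩ := edge_support τ he
    have hne : ∀ x ∈ τ.support, x j ≠ 0 := by
      intro x hx h
      have := hτs x hx j
      rw [h, Set.mem_uIcc] at this
      simp only [Pi.add_apply, Pi.single_eq_same, Pi.single_eq_of_ne hij.symm, zero_add] at this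
      rcases ht' with rfl | rfl <;> omega
    exact cheap_of_ne hij (hne x hx) (hne y hy)
  · intro p
    left
    have := length_ge p
    simp only [Pi.zero_apply, zero_sub, abs_neg] at this
    omega

/-- The case of a single nonzero coordinate. -/
lemma case_axis {d n : ℕ} {i j : Fin d} (hij : i ≠ j) {a b : ℝ} (ha : 0 < a) (hab : a < b)
    (z : Vtx d) (hbz : inBox n z) (hn : 1 ≤ n) {s : ℤ} (hs : |s| = 1)
    (hi : 3 ≤ s * z i) (hj : z j = 0) (hk : ∀ k, k ≠ i → z k = 0)
    (hbig : ((s * z i : ℤ) + 1) * a + b ≤ b * ((s * z i : ℤ) - 2)) :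
    (∃ (S : Finset (Sym2 (Vtx d))) (ω : Sym2 (Vtx d) → ℝ), ↑S ⊆ EdgeSet d n ∧ S.card = 3 ∧
      ValidEnv d n a b ω ∧ envDerivOn a b S (gT (boxG d n) 0 z) ω = b - a) ∧
    (∃ (S : Finset (Sym2 (Vtx d))) (ω : Sym2 (Vtx d) → ℝ), ↑S ⊆ EdgeSet d n ∧ S.card = 3 ∧
      ValidEnv d n a b ω ∧ envDerivOn a b S (gT (boxG d n) 0 z) ω = -(b - a)) := by
  have hs' : s = 1 ∨ s = -1 := eq_or_eq_neg_of_abs_eq hs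
  set y : Vtx d := z + Pi.single j 1 with hy
  have hyj : y j = 1 := by simp [hy, hj]
  have hyi : y i = z i := by simp [hy, hij]
  have hyb : inBox n y := by
    intro k
    have := hbz k
    rw [abs_le] at this ⊢
    by_cases h : k = j
    · subst h
      rw [hyj]
      omega
    · have : y k = z k := by simp [hy, h]
      omega
  obtain ⟨m, hm⟩ := Int.eq_ofNat_of_zero_le (a := ∑ k, |(Pi.single i (2 * s) + Pi.single j 1 :
    Vtx d) k - y k|) (Finset.sum_nonneg fun k _ => abs_nonneg _)
  have hsum := sum_abs_corner y hij hs (t := 1) (by simp) (by rw [hyi]; omega) (by rw [hyj]; simp)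
  have hzi : |z i| = s * z i := by
    rcases hs' with rfl | rfl
    · rw [abs_of_nonneg (by omega)]; ring
    · rw [abs_of_nonpos (by omega)]; ring
  have hsy : ∑ k, |y k| = s * z i + 1 := by
    have key : ∀ k, |y k| = (if k = i then s * z i else 0) + (if k = j then 1 else 0) := by
      intro k
      by_cases h1 : k = i
      · subst h1
        simp [hyi, hzi, hij]
      · by_cases h2 : k = j
        · subst h2
          simp [hyj, h1]
        · simp [hy, h1, h2, hk k h1]
    rw [Finset.sum_congr rfl fun k _ => key k, Finset.sum_add_distrib]
    simp
  have hb3 : inBox n (Pi.single i (2 * s) + Pi.single j 1 : Vtx d) := by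
    intro k
    simp only [Pi.add_apply, Pi.single_apply]
    rw [abs_le]
    split_ifs with h1 h2
    · exact absurd (h1.symm.trans h2) hij
    all_goals omega
  obtain ⟨τ, hτ, hτs⟩ := mono_walk y hyb m _ hb3 hm
  have hadj : (boxG d n).Adj z y := ⟨single_step z j 1 (by simp), hbz, hyb⟩
  have hz3 : z ≠ 0 ∧ z ≠ Pi.single i s ∧ z ≠ Pi.single i (2 * s) := by
    refine ⟨?_, ?_, ?_⟩ <;>
    · rintro rfl
      simp at hi
      try (rcases hs' with rfl | rfl <;> omega)
  have hmN : (m : ℤ) + 2 = s * z i := by omega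
  refine concrete_gadget hij hs (t := 1) (by simp) hn ha hab z hz3 (m := m + 1)
    (τ.append (SimpleGraph.Walk.cons hadj.symm SimpleGraph.Walk.nil)) (by simp [hτ]) ?_ ?_
  · intro e he
    rw [SimpleGraph.Walk.edges_append] at he
    rcases List.mem_append.1 he with he | he
    · obtain ⟨x, x', rfl, hx, hx'⟩ := edge_support τ he
      have hne : ∀ x ∈ τ.support, x j ≠ 0 := by
        intro x hx h
        have := hτs x hx j
        rw [h, Set.mem_uIcc] at this
        simp only [Pi.add_apply, Pi.single_eq_same, Pi.single_eq_of_ne hij.symm, zero_add] at this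
        omega
      exact cheap_of_ne hij (hne x hx) (hne x' hx')
    · simp only [SimpleGraph.Walk.edges_cons, SimpleGraph.Walk.edges_nil,
        List.mem_singleton] at he
      subst he
      have hyc := cheap_of_ne (i := i) (s := s) hij (x := y) (y := y) (by omega) (by omega)
      refine ⟨?_, y, by simp, by omega⟩
      intro x hx
      rcases Sym2.mem_iff.1 hx with rfl | rfl
      · exact hyc.1 _ (by simp)
      · exact hz3
  · intro p
    by_cases hp : ∃ x ∈ p.support, x j ≠ 0
    · left
      obtain ⟨x, hx, hxj⟩ := hp
      have l1 := length_ge (p.takeUntil x hx)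
      have l2 := length_ge (p.dropUntil x hx)
      have l3 : (p.takeUntil x hx).length + (p.dropUntil x hx).length = p.length := by
        rw [← SimpleGraph.Walk.length_append, SimpleGraph.Walk.take_spec]
      have l4 : s * z i + 2 ≤ (∑ k, |(0 : Vtx d) k - x k|) + ∑ k, |x k - z k| := by
        have : ∑ k, ((if k = i then s * z i else 0) + (if k = j then (2 : ℤ) else 0)) =
          s * z i + 2 := by
          rw [Finset.sum_add_distrib]
          simp
        rw [← this, ← Finset.sum_add_distrib]
        apply Finset.sum_le_sum
        intro k _
        simp only [Pi.zero_apply, zero_sub, abs_neg]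
        by_cases h1 : k = i
        · subst h1
          simp only [if_true, if_neg hij, ← hzi]
          have := abs_sub_abs_le_abs_sub (z k) (x k)
          rw [abs_sub_comm (z k)] at this
          omega
        · by_cases h2 : k = j
          · subst h2
            have : 1 ≤ |x k| := Int.one_le_abs hxj
            simp only [if_neg h1, if_true, hj, sub_zero]
            omega
          · simp only [if_neg h1, if_neg h2]
            positivity
      omega
    · right
      push Not at hp
      intro ω hge hb
      set ψ : Vtx d → ℝ := fun x => b * max 0 ((s * x i : ℤ) - 2 : ℝ) with hψ
      have hpot := wt_ge_potential (ω := ω) ψ p (by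
        intro x x' he
        have hx := hp x (p.fst_mem_support_of_mem_edges he)
        have hx' := hp x' (p.snd_mem_support_of_mem_edges he)
        have hge' := hge _ he
        by_cases c1 : s(x, x') = s(0, Pi.single i s)
        · have : ψ x = 0 ∧ ψ x' = 0 := by
            rw [Sym2.eq_iff] at c1
            rcases c1 with ⟨rfl, rfl⟩ | ⟨rfl, rfl⟩ <;> rcases hs' with rfl | rfl <;>
              simp [hψ] <;> norm_num
          rw [this.1, this.2]
          linarith
        by_cases c2 : s(x, x') = s(Pi.single i s, Pi.single i (2 * s))
        · have : ψ x = 0 ∧ ψ x' = 0 := by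
            rw [Sym2.eq_iff] at c2
            rcases c2 with ⟨rfl, rfl⟩ | ⟨rfl, rfl⟩ <;> rcases hs' with rfl | rfl <;>
              simp [hψ] <;> norm_num
          rw [this.1, this.2]
          linarith
        have hωb : ω s(x, x') = b := by
          apply hb _ he
          · rintro ⟨_, w, hw, hwj⟩
            rcases Sym2.mem_iff.1 hw with rfl | rfl
            · exact hwj hx
            · exact hwj hx'
          · intro h
            rw [Sym2.eq_iff] at h
            rcases h with ⟨rfl, rfl⟩ | ⟨rfl, rfl⟩ <;> simp at hx hx'
          · exact c1
          · exact c2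
          · intro h
            rw [Sym2.eq_iff] at h
            rcases h with ⟨rfl, rfl⟩ | ⟨rfl, rfl⟩ <;> simp [hij.symm] at hx hx'
        rw [hωb]
        have hadj : (boxG d n).Adj x x' := p.adj_of_mem_edges he
        have h1 : (∑ k, |x k - x' k|) = 1 := hadj.1
        have h2 : |x i - x' i| ≤ 1 := by
          rw [← h1]
          exact Finset.single_le_sum (f := fun k => |x k - x' k|)
            (fun k _ => abs_nonneg _) (Finset.mem_univ i)
        have h3 : s * x' i ≤ s * x i + 1 := by
          rw [abs_le] at h2
          rcases hs' with rfl | rfl <;> omega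
        have h4 : ((s * x' i : ℤ) : ℝ) ≤ (s * x i : ℤ) + 1 := by exact_mod_cast h3
        have h5 : max 0 (((s * x' i : ℤ) : ℝ) - 2) ≤ max 0 (((s * x i : ℤ) : ℝ) - 2) + 1 := by
          apply max_le
          · have := le_max_left 0 (((s * x i : ℤ) : ℝ) - 2)
            linarith
          · have := le_max_right 0 (((s * x i : ℤ) : ℝ) - 2)
            linarith
        have := mul_le_mul_of_nonneg_left h5 (ha.trans hab).le
        simp only [hψ]
        linarith)
      have e1 : ψ 0 = 0 := by simp [hψ]
      have e2 : b * ((s * z i : ℤ) - 2) ≤ ψ z :=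
        mul_le_mul_of_nonneg_left (le_max_right _ _) (ha.trans hab).le
      have e3 : ((s * z i : ℤ) : ℝ) = m + 2 := by exact_mod_cast hmN.symm
      rw [e3] at hbig e2
      push_cast
      linarith

lemma attained (d : ℕ) (hd : 3 ≤ d) (a b : ℝ) (ha : 0 < a)
    (hab : a < b) (v : Vtx d) (hv : ∀ i, |v i| ≤ 2) (hv0 : v ≠ 0) :
    ∃ n : ℕ, (∃ (S : Finset (Sym2 (Vtx d))) (ω : Sym2 (Vtx d) → ℝ), ↑S ⊆ EdgeSet d n ∧
      S.card = 3 ∧ ValidEnv d n a b ω ∧ envDerivOn a b S (fppT d v n) ω = b - a) ∧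
    (∃ (S : Finset (Sym2 (Vtx d))) (ω : Sym2 (Vtx d) → ℝ), ↑S ⊆ EdgeSet d n ∧ S.card = 3 ∧
      ValidEnv d n a b ω ∧ envDerivOn a b S (fppT d v n) ω = -(b - a)) := by
  obtain ⟨i, hi⟩ : ∃ i, v i ≠ 0 := by
    by_contra h
    push Not at h
    exact hv0 (funext h)
  obtain ⟨n0, hn0⟩ := exists_nat_ge (4 * a / (b - a))
  obtain ⟨n, hn⟩ : ∃ n, n = n0 + 3 := ⟨_, rfl⟩
  have hn1 : 4 * a ≤ ((n : ℝ) - 3) * (b - a) := by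
    rw [div_le_iff₀ (by linarith)] at hn0
    have : (n : ℝ) - 3 = n0 := by rw [hn]; push_cast; ring
    rw [this]
    exact hn0
  refine ⟨n, ?_⟩
  rw [fppT_eq]
  set z : Vtx d := fun k => (n : ℤ) * v k with hz
  have hbz : inBox n z := by
    intro k
    simp only [hz, abs_mul, Nat.abs_cast]
    nlinarith [hv k]
  obtain ⟨s, hs, hsv⟩ := exists_sign_s17 (v i) hi
  have hsz : (n : ℤ) ≤ s * z i := by
    have : s * z i = n * (s * v i) := by simp only [hz]; ring
    rw [this]
    nlinarith
  by_cases hj : ∃ j, j ≠ i ∧ v j ≠ 0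
  · obtain ⟨j, hji, hvj⟩ := hj
    obtain ⟨t, ht, htv⟩ := exists_sign_s17 (v j) hvj
    refine case_two hji.symm ha hab z hbz (by omega) hs ht (by omega) ?_
    have : t * z j = n * (t * v j) := by simp only [hz]; ring
    rw [this]
    have : (1 : ℤ) ≤ n := by omega
    nlinarith
  · push Not at hj
    obtain ⟨j, hji⟩ : ∃ j : Fin d, j ≠ i := by
      have : Nontrivial (Fin d) := Fin.nontrivial_iff_two_le.2 (by omega)
      exact exists_ne i
    refine case_axis hji.symm ha hab z hbz (by omega) hs (by omega) (by simp [hz, hj j hji])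
      (fun k hk => by simp [hz, hj k hk]) ?_
    have h1 : (n : ℝ) ≤ (s * z i : ℤ) := by exact_mod_cast hsz
    have h2 := mul_le_mul_of_nonneg_right (sub_le_sub_right h1 3) (sub_nonneg.2 hab.le)
    nlinarith

/--
In dimensions `d ≥ 3`, the third-order extremal values satisfy `U₃ = 1`
and `L₃ = −1`: for every `n`, every `S ⊆ W_n` with `|S| = 3`, and every `ω ∈ Ω_n` one has
`−(b−a) ≤ ∂_S f_n(ω) ≤ b−a`; moreover there exist `n`, `S` with `|S| = 3`, and `ω` with
`∂_S f_n(ω) = b−a`, and there exist `n`, `S` with `|S| = 3`, and `ω` with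
`∂_S f_n(ω) = −(b−a)`.
-/
theorem extremal_third_deriv_values (d : ℕ) (hd : 3 ≤ d) (a b : ℝ) (ha : 0 < a)
    (hab : a < b) (v : Vtx d) (hv : ∀ i, |v i| ≤ 2) (hv0 : v ≠ 0) :
    (∀ (n : ℕ) (S : Finset (Sym2 (Vtx d))), ↑S ⊆ EdgeSet d n → S.card = 3 →
      ∀ ω : Sym2 (Vtx d) → ℝ, ValidEnv d n a b ω →
        -(b - a) ≤ envDerivOn a b S (fppT d v n) ω ∧
        envDerivOn a b S (fppT d v n) ω ≤ b - a) ∧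
    (∃ (n : ℕ) (S : Finset (Sym2 (Vtx d))) (ω : Sym2 (Vtx d) → ℝ),
       ↑S ⊆ EdgeSet d n ∧ S.card = 3 ∧ ValidEnv d n a b ω ∧
       envDerivOn a b S (fppT d v n) ω = b - a) ∧
    (∃ (n : ℕ) (S : Finset (Sym2 (Vtx d))) (ω : Sym2 (Vtx d) → ℝ),
       ↑S ⊆ EdgeSet d n ∧ S.card = 3 ∧ ValidEnv d n a b ω ∧
       envDerivOn a b S (fppT d v n) ω = -(b - a)) := by
  refine ⟨?_, ?_, ?_⟩
  · intro n S hS hc ω hω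
    rw [fppT_eq]
    have hbox : inBox n (fun i => (n : ℤ) * v i) := by
      intro k
      simp only [abs_mul, Nat.abs_cast]
      nlinarith [hv k]
    have hbox0 : inBox n (0 : Vtx d) := by
      intro k
      simp
    obtain ⟨m, hm⟩ := Int.eq_ofNat_of_zero_le (a := ∑ k, |(0 : Vtx d) k - (n : ℤ) * v k|)
      (Finset.sum_nonneg fun k _ => abs_nonneg _)
    obtain ⟨p, _⟩ := mono_walk _ hbox m _ hbox0 hm
    exact third_bounds_env ha hab p S hc ω (by rw [boxG_edgeSet]; exact hω)
  · obtain ⟨n, ⟨S, ω, h⟩, _⟩ := attained d hd a b ha hab v hv hv0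
    exact ⟨n, S, ω, h⟩
  · obtain ⟨n, _, ⟨S, ω, h⟩⟩ := attained d hd a b ha hab v hv hv0
    exact ⟨n, S, ω, h⟩

end
end
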